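/- arXiv:1903.02126 — 3 statements merged into one kernel-verified Lean document; each statement's English description precedes it below -/
import Mathlib

section
/- Let Ω ⊂ ℝ^d be compact, c : Ω × Ω → ℝ Lipschitz continuous, and ψ^± ∈ C(∂Ω) satisfy the no-arbitrage condition ψ⁻(y) − ψ⁺(x) ≤ c(x,y) for all x,y ∈ ∂Ω. Then the total cost functional π ↦ ∫_{Ω×Ω} c dπ + ∫_{∂Ω} ψ⁺ d(π_x) − ∫_{∂Ω} ψ⁻ d(π_y) attains its infimum over 𝒫₀(μ⁺,μ⁻), i.e., Problem 𝒯₁ admits an optimal transport plan. -/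
open MeasureTheory Set

noncomputable section

abbrev Euc (d : ℕ) := EuclideanSpace ℝ (Fin d)

variable {d : ℕ}

/-- The admissible set `𝒫₀(μ⁺,μ⁻)`: finite positive measures on `Ω × Ω` whose first
marginal restricted to the interior of `Ω` is `μ⁺` and whose second marginal restricted to
the interior of `Ω` is `μ⁻` (the boundary parts of the marginals are free). -/
def P0 (Ω : Set (Euc d)) (μp μm : Measure (Euc d)) : Set (Measure (Euc d × Euc d)) :=
  {π | IsFiniteMeasure π ∧ π ((Ω ×ˢ Ω)ᶜ) = 0 ∧
    (π.map Prod.fst).restrict (interior Ω) = μp ∧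
    (π.map Prod.snd).restrict (interior Ω) = μm}

/-- Total cost with boundary tariffs:
`∫ c dπ + ∫_{∂Ω} ψ⁺ dπ_x − ∫_{∂Ω} ψ⁻ dπ_y`. -/
def tariffCost (Ω : Set (Euc d)) (c : Euc d → Euc d → ℝ) (ψp ψm : Euc d → ℝ)
    (π : Measure (Euc d × Euc d)) : ℝ :=
  (∫ p, c p.1 p.2 ∂π) + (∫ x in frontier Ω, ψp x ∂(π.map Prod.fst))
    - ∫ y in frontier Ω, ψm y ∂(π.map Prod.snd)

theorem aux_tietze {X : Type*} [TopologicalSpace X] [NormalSpace X] [T2Space X] {K : Set X}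
    (hK : IsCompact K) {f : X → ℝ} (hf : ContinuousOn f K) :
    ∃ g : BoundedContinuousFunction X ℝ, ∀ x ∈ K, g x = f x := by
  have : CompactSpace K := isCompact_iff_compactSpace.1 hK
  obtain ⟨g, -, hg⟩ := BoundedContinuousFunction.exists_extension_norm_eq_of_isClosedEmbedding
    (BoundedContinuousFunction.mkOfCompact ⟨K.domRestrict f, hf.domRestrict⟩)
    hK.isClosed.isClosedEmbedding_subtypeVal
  refine ⟨g, fun x hx => ?_⟩
  exact congrFun hg ⟨x, hx⟩

theorem aux_split {X : Type*} [TopologicalSpace X] [MeasurableSpace X] [BorelSpace X]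
    {Ω : Set X} (hΩ : IsClosed Ω) (ν : Measure X) (h : ν Ωᶜ = 0) :
    ν = ν.restrict (interior Ω) + ν.restrict (frontier Ω) := by
  have hd : Disjoint (interior Ω) (frontier Ω) := disjoint_interior_frontier
  rw [← Measure.restrict_union hd isClosed_frontier.measurableSet]
  have : interior Ω ∪ frontier Ω = Ω := by
    rw [hΩ.frontier_eq]; exact union_sdiff_cancel interior_subset
  rw [this]
  refine (Measure.restrict_eq_self_of_ae_mem ?_).symm
  exact h

theorem aux_closed {X : Type*} [TopologicalSpace X] [MeasurableSpace X] [BorelSpace X]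
    {Ω : Set X} (σ μ : Measure X) (hμ : μ (interior Ω)ᶜ = 0)
    (hσ : σ (frontier Ω)ᶜ = 0) : (μ + σ).restrict (interior Ω) = μ := by
  rw [Measure.restrict_add]
  have h1 : μ.restrict (interior Ω) = μ := Measure.restrict_eq_self_of_ae_mem hμ
  have h2 : σ.restrict (interior Ω) = 0 := by
    rw [Measure.restrict_eq_zero]
    refine measure_mono_null ?_ hσ
    exact disjoint_interior_frontier.subset_compl_right
  rw [h1, h2, add_zero]

theorem aux_map_null_fst {X Y : Type*} [MeasurableSpace X] [MeasurableSpace Y]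
    {A : Set X} {B : Set Y} (hA : MeasurableSet A) (π : Measure (X × Y))
    (h : π (A ×ˢ B)ᶜ = 0) : (π.map Prod.fst) Aᶜ = 0 := by
  rw [Measure.map_apply measurable_fst hA.compl]
  exact measure_mono_null (t := (A ×ˢ B)ᶜ) (fun p hp hp' => hp hp'.1) h

theorem aux_map_null_snd {X Y : Type*} [MeasurableSpace X] [MeasurableSpace Y]
    {A : Set X} {B : Set Y} (hB : MeasurableSet B) (π : Measure (X × Y))
    (h : π (A ×ˢ B)ᶜ = 0) : (π.map Prod.snd) Bᶜ = 0 := by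
  rw [Measure.map_apply measurable_snd hB.compl]
  exact measure_mono_null (t := (A ×ˢ B)ᶜ) (fun p hp hp' => hp hp'.2) h

theorem aux_bdry {X : Type*} [TopologicalSpace X] [MeasurableSpace X] [BorelSpace X]
    {Ω : Set X} (hΩ : IsClosed Ω) (ν μ : Measure X) [IsFiniteMeasure ν] (h : ν Ωᶜ = 0)
    (hr : ν.restrict (interior Ω) = μ) (ψ : X → ℝ) (g : BoundedContinuousFunction X ℝ)
    (hg : ∀ x ∈ frontier Ω, g x = ψ x) :
    ∫ x in frontier Ω, ψ x ∂ν = ∫ x, g x ∂ν - ∫ x, g x ∂μ := by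
  have h1 : ∫ x in frontier Ω, ψ x ∂ν = ∫ x in frontier Ω, g x ∂ν :=
    setIntegral_congr_fun isClosed_frontier.measurableSet (fun x hx => (hg x hx).symm)
  have h2 : ∫ x, g x ∂ν = ∫ x in interior Ω, g x ∂ν + ∫ x in frontier Ω, g x ∂ν := by
    conv_lhs => rw [aux_split hΩ ν h]
    exact integral_add_measure (g.integrable _) (g.integrable _)
  rw [h1, h2, hr]; ring

theorem aux_cost (Ω : Set (Euc d)) (hΩ : IsClosed Ω) (c : Euc d → Euc d → ℝ)
    (ψp ψm : Euc d → ℝ) (μp μm : Measure (Euc d))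
    (C : BoundedContinuousFunction (Euc d × Euc d) ℝ)
    (P M : BoundedContinuousFunction (Euc d) ℝ)
    (hC : ∀ p ∈ Ω ×ˢ Ω, C p = c p.1 p.2)
    (hP : ∀ x ∈ frontier Ω, P x = ψp x) (hM : ∀ x ∈ frontier Ω, M x = ψm x)
    (π : Measure (Euc d × Euc d)) (hπ : π ∈ P0 Ω μp μm) :
    tariffCost Ω c ψp ψm π =
      ∫ p, (C + P.compContinuous ⟨Prod.fst, continuous_fst⟩
        - M.compContinuous ⟨Prod.snd, continuous_snd⟩ :
          BoundedContinuousFunction (Euc d × Euc d) ℝ) p ∂π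
      - (∫ x, P x ∂μp - ∫ x, M x ∂μm) := by
  obtain ⟨hfin, hsupp, h1, h2⟩ := hπ
  have e1 : ∫ p, c p.1 p.2 ∂π = ∫ p, C p ∂π := by
    refine integral_congr_ae ?_
    have : ∀ᵐ p ∂π, p ∈ Ω ×ˢ Ω := hsupp
    filter_upwards [this] with p hp using (hC p hp).symm
  have e2 := aux_bdry hΩ _ _ (aux_map_null_fst hΩ.measurableSet π hsupp) h1 ψp P hP
  have e3 := aux_bdry hΩ _ _ (aux_map_null_snd hΩ.measurableSet π hsupp) h2 ψm M hM
  rw [integral_map measurable_fst.aemeasurable P.continuous.aestronglyMeasurable] at e2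
  rw [integral_map measurable_snd.aemeasurable M.continuous.aestronglyMeasurable] at e3
  unfold tariffCost
  rw [e1, e2, e3]
  have i2 : Integrable (fun p : Euc d × Euc d => P p.1) π := (P.compContinuous ⟨Prod.fst, continuous_fst⟩ :
    BoundedContinuousFunction (Euc d × Euc d) ℝ).integrable π
  have i3 : Integrable (fun p : Euc d × Euc d => M p.2) π := (M.compContinuous ⟨Prod.snd, continuous_snd⟩ :
    BoundedContinuousFunction (Euc d × Euc d) ℝ).integrable π
  have : ∫ p, (C + P.compContinuous ⟨Prod.fst, continuous_fst⟩
        - M.compContinuous ⟨Prod.snd, continuous_snd⟩ :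
          BoundedContinuousFunction (Euc d × Euc d) ℝ) p ∂π
      = ∫ p, C p ∂π + ∫ p, P p.1 ∂π - ∫ p, M p.2 ∂π := by
    rw [← integral_add (C.integrable π) i2, ← integral_sub (f := fun p => C p + P p.1)
      ((C.integrable π).add i2) i3]
    rfl
  rw [this]; ring

theorem aux_restrict (Ω : Set (Euc d)) (hΩ : IsClosed Ω) (μp μm : Measure (Euc d))
    (π : Measure (Euc d × Euc d)) (hπ : π ∈ P0 Ω μp μm) :
    π.restrict (frontier Ω ×ˢ frontier Ω)ᶜ ∈ P0 Ω μp μm ∧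
    π.restrict (frontier Ω ×ˢ frontier Ω)ᶜ univ ≤ μp univ + μm univ := by
  obtain ⟨hfin, hsupp, h1, h2⟩ := hπ
  have hd : Disjoint (interior Ω) (frontier Ω) := disjoint_interior_frontier
  refine ⟨⟨inferInstance, ?_, ?_, ?_⟩, ?_⟩
  · exact le_antisymm ((Measure.restrict_apply_le _ _).trans hsupp.le) bot_le
  · rw [← h1]
    ext s hs
    rw [Measure.restrict_apply hs, Measure.restrict_apply hs]
    have hs' := hs.inter (isOpen_interior (s := Ω)).measurableSet
    rw [Measure.map_apply measurable_fst hs', Measure.map_apply measurable_fst hs',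
      Measure.restrict_apply (measurable_fst hs')]
    congr 1
    refine inter_eq_left.2 fun p hp hp' => ?_
    exact disjoint_left.1 hd hp.2 hp'.1
  · rw [← h2]
    ext s hs
    rw [Measure.restrict_apply hs, Measure.restrict_apply hs]
    have hs' := hs.inter (isOpen_interior (s := Ω)).measurableSet
    rw [Measure.map_apply measurable_snd hs', Measure.map_apply measurable_snd hs',
      Measure.restrict_apply (measurable_snd hs')]
    congr 1
    refine inter_eq_left.2 fun p hp hp' => ?_
    exact disjoint_left.1 hd hp.2 hp'.2
  · have hi := (isOpen_interior (s := Ω)).measurableSet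
    have a1 : μp univ = π (Prod.fst ⁻¹' interior Ω) := by
      rw [← h1, Measure.restrict_apply_univ, Measure.map_apply measurable_fst hi]
    have a2 : μm univ = π (Prod.snd ⁻¹' interior Ω) := by
      rw [← h2, Measure.restrict_apply_univ, Measure.map_apply measurable_snd hi]
    rw [Measure.restrict_apply_univ, a1, a2]
    have hsub : (frontier Ω ×ˢ frontier Ω)ᶜ ⊆
        (Ω ×ˢ Ω)ᶜ ∪ (Prod.fst ⁻¹' interior Ω ∪ Prod.snd ⁻¹' interior Ω) := by
      intro p hp
      rw [hΩ.frontier_eq] at hp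
      simp only [mem_compl_iff, mem_prod, mem_sdiff, mem_union, mem_preimage] at hp ⊢
      tauto
    refine (measure_mono hsub).trans ((measure_union_le _ _).trans ?_)
    rw [hsupp, zero_add]
    exact measure_union_le _ _

theorem aux_nonempty (Ω : Set (Euc d)) (hΩ : IsClosed Ω) (hfr : (frontier Ω).Nonempty)
    (μp μm : Measure (Euc d)) [IsFiniteMeasure μp] [IsFiniteMeasure μm]
    (hμp : μp (interior Ω)ᶜ = 0) (hμm : μm (interior Ω)ᶜ = 0) :
    (P0 Ω μp μm).Nonempty := by
  obtain ⟨x, hx⟩ := hfr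
  have hxΩ : x ∈ Ω := hΩ.frontier_subset hx
  have hO : MeasurableSet Ω := hΩ.measurableSet
  have hsp : μp Ωᶜ = 0 := measure_mono_null (compl_subset_compl.2 interior_subset) hμp
  have hsm : μm Ωᶜ = 0 := measure_mono_null (compl_subset_compl.2 interior_subset) hμm
  have hdir : ∀ a : ENNReal, (a • Measure.dirac x) (frontier Ω)ᶜ = 0 := by
    intro a
    simp [hx, isClosed_frontier.measurableSet]
  have hdir2 : (Measure.dirac x) Ωᶜ = 0 := by
    simp [hxΩ, hO]
  refine ⟨μp.prod (Measure.dirac x) + (Measure.dirac x).prod μm, inferInstance, ?_, ?_, ?_⟩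
  · have hsub : (Ω ×ˢ Ω)ᶜ ⊆ (Ωᶜ ×ˢ (univ : Set (Euc d))) ∪ ((univ : Set (Euc d)) ×ˢ Ωᶜ) := by
      intro p hp
      simp only [mem_compl_iff, mem_prod, mem_union, mem_univ] at hp ⊢
      tauto
    refine measure_mono_null hsub (measure_union_null ?_ ?_)
    · simp [Measure.prod_prod, hsp, hdir2]
    · simp [Measure.prod_prod, hsm, hdir2]
  · rw [Measure.map_add _ _ measurable_fst, Measure.map_fst_prod, Measure.map_fst_prod,
      measure_univ, one_smul]
    exact aux_closed _ _ hμp (hdir _)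
  · rw [Measure.map_add _ _ measurable_snd, Measure.map_snd_prod, Measure.map_snd_prod,
      measure_univ (μ := Measure.dirac x), one_smul, add_comm]
    exact aux_closed _ _ hμm (hdir _)

theorem aux_compact (Ω : Set (Euc d)) (hΩ : IsCompact Ω)
    (μp μm : Measure (Euc d)) [IsFiniteMeasure μp] [IsFiniteMeasure μm]
    (hμp : μp (interior Ω)ᶜ = 0) (hμm : μm (interior Ω)ᶜ = 0) (R : NNReal) :
    IsCompact {π : FiniteMeasure (Euc d × Euc d) |
      π.mass ≤ R ∧ (π : Measure (Euc d × Euc d)) ∈ P0 Ω μp μm} := by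
  have hcl := hΩ.isClosed
  have hfc : IsCompact (frontier Ω) := hΩ.of_isClosed_subset isClosed_frontier
    hcl.frontier_subset
  let T : Set (FiniteMeasure (Euc d)) := {σ | σ.mass ≤ R ∧ σ (frontier Ω)ᶜ = 0}
  have hT : IsCompact T := isCompact_setOfPred_finiteMeasure_le_of_isCompact R hfc
  let A : Set (FiniteMeasure (Euc d × Euc d)) := {π | π.mass ≤ R ∧ π (Ω ×ˢ Ω)ᶜ = 0}
  have hA : IsCompact A := isCompact_setOfPred_finiteMeasure_le_of_isCompact R (hΩ.prod hΩ)
  let mp : FiniteMeasure (Euc d) := ⟨μp, inferInstance⟩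
  let mm : FiniteMeasure (Euc d) := ⟨μm, inferInstance⟩
  have hTp : IsClosed ((fun σ => mp + σ) '' T) := (hT.image (by fun_prop)).isClosed
  have hTm : IsClosed ((fun σ => mm + σ) '' T) := (hT.image (by fun_prop)).isClosed
  have key : ∀ (ν m : FiniteMeasure (Euc d)), ν.mass ≤ R → (ν : Measure (Euc d)) Ωᶜ = 0 →
      (ν : Measure (Euc d)).restrict (interior Ω) = m → ν ∈ (fun σ => m + σ) '' T := by
    intro ν m hν hsup hm
    refine ⟨ν.restrict (frontier Ω), ⟨?_, ?_⟩, ?_⟩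
    · rw [FiniteMeasure.restrict_mass]; exact (ν.apply_le_mass _).trans hν
    · rw [FiniteMeasure.restrict_apply _ _ isClosed_frontier.measurableSet.compl]
      simp
    · apply FiniteMeasure.toMeasure_injective
      change (m : Measure (Euc d)) + (ν : Measure (Euc d)).restrict (frontier Ω) = ν
      rw [← hm]
      exact (aux_split hcl _ hsup).symm
  have heq : {π : FiniteMeasure (Euc d × Euc d) |
      π.mass ≤ R ∧ (π : Measure (Euc d × Euc d)) ∈ P0 Ω μp μm} =
      A ∩ ((fun π => π.map Prod.fst) ⁻¹' ((fun σ => mp + σ) '' T) ∩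
        (fun π => π.map Prod.snd) ⁻¹' ((fun σ => mm + σ) '' T)) := by
    ext π
    constructor
    · rintro ⟨hR, -, hsupp, h1, h2⟩
      refine ⟨⟨hR, (FiniteMeasure.null_iff_toMeasure_null _ _).2 hsupp⟩, ?_, ?_⟩
      · exact key _ mp ((FiniteMeasure.mass_map_le _ _).trans hR)
          (aux_map_null_fst hcl.measurableSet _ hsupp) h1
      · exact key _ mm ((FiniteMeasure.mass_map_le _ _).trans hR)
          (aux_map_null_snd hcl.measurableSet _ hsupp) h2
    · rintro ⟨⟨hR, hsupp⟩, ⟨σ, hσ, h1⟩, ⟨τ, hτ, h2⟩⟩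
      refine ⟨hR, inferInstance, (FiniteMeasure.null_iff_toMeasure_null _ _).1 hsupp, ?_, ?_⟩
      · have h1' : μp + (σ : Measure (Euc d)) = (π : Measure (Euc d × Euc d)).map Prod.fst :=
          congrArg FiniteMeasure.toMeasure h1
        rw [← h1']
        exact aux_closed _ _ hμp ((FiniteMeasure.null_iff_toMeasure_null _ _).1 hσ.2)
      · have h2' : μm + (τ : Measure (Euc d)) = (π : Measure (Euc d × Euc d)).map Prod.snd :=
          congrArg FiniteMeasure.toMeasure h2
        rw [← h2']
        exact aux_closed _ _ hμm ((FiniteMeasure.null_iff_toMeasure_null _ _).1 hτ.2)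
  rw [heq]
  refine hA.inter_right (IsClosed.inter ?_ ?_)
  · exact hTp.preimage (FiniteMeasure.continuous_map continuous_fst)
  · exact hTm.preimage (FiniteMeasure.continuous_map continuous_snd)

/-- part of Proposition 3.1: the tariff transport problem `𝒯₁` admits an
optimal transport plan. -/
theorem exists_optimal_tariff_plan (Ω : Set (Euc d)) (hΩ : IsCompact Ω)
    (hΩne : Ω.Nonempty) (hfr : (frontier Ω).Nonempty)
    (c : Euc d → Euc d → ℝ) (K : NNReal)
    (hc : LipschitzOnWith K (fun p : Euc d × Euc d => c p.1 p.2) (Ω ×ˢ Ω))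
    (ψp ψm : Euc d → ℝ)
    (hψp : ContinuousOn ψp (frontier Ω)) (hψm : ContinuousOn ψm (frontier Ω))
    (noarb : ∀ x ∈ frontier Ω, ∀ y ∈ frontier Ω, ψm y - ψp x ≤ c x y)
    (μp μm : Measure (Euc d)) [IsFiniteMeasure μp] [IsFiniteMeasure μm]
    (hμp : μp (interior Ω)ᶜ = 0) (hμm : μm (interior Ω)ᶜ = 0) :
    ∃ π ∈ P0 Ω μp μm, ∀ π' ∈ P0 Ω μp μm,
      tariffCost Ω c ψp ψm π ≤ tariffCost Ω c ψp ψm π' := by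
  have hcl := hΩ.isClosed
  have hfc : IsCompact (frontier Ω) := hΩ.of_isClosed_subset isClosed_frontier
    hcl.frontier_subset
  obtain ⟨C, hC⟩ := aux_tietze (hΩ.prod hΩ) hc.continuousOn
  obtain ⟨P, hP⟩ := aux_tietze hfc hψp
  obtain ⟨M, hM⟩ := aux_tietze hfc hψm
  have hcost := aux_cost Ω hcl c ψp ψm μp μm C P M hC hP hM
  set F : BoundedContinuousFunction (Euc d × Euc d) ℝ :=
    C + P.compContinuous ⟨Prod.fst, continuous_fst⟩
        - M.compContinuous ⟨Prod.snd, continuous_snd⟩ with hF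
  let R : NNReal := (μp univ + μm univ).toNNReal
  have hRtop : μp univ + μm univ ≠ ⊤ :=
    ENNReal.add_ne_top.2 ⟨measure_ne_top _ _, measure_ne_top _ _⟩
  let S : Set (FiniteMeasure (Euc d × Euc d)) :=
    {π | π.mass ≤ R ∧ (π : Measure (Euc d × Euc d)) ∈ P0 Ω μp μm}
  have hS : IsCompact S := aux_compact Ω hΩ μp μm hμp hμm R
  have hmem : ∀ π' ∈ P0 Ω μp μm, ∃ ρ ∈ S,
      (ρ : Measure (Euc d × Euc d)) = π'.restrict (frontier Ω ×ˢ frontier Ω)ᶜ := by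
    intro π' hπ'
    obtain ⟨h1, h2⟩ := aux_restrict Ω hcl μp μm π' hπ'
    exact ⟨⟨_, h1.1⟩, ⟨ENNReal.toNNReal_mono hRtop h2, h1⟩, rfl⟩
  have hSne : S.Nonempty := by
    obtain ⟨π', hπ'⟩ := aux_nonempty Ω hcl hfr μp μm hμp hμm
    obtain ⟨ρ, hρ, -⟩ := hmem π' hπ'
    exact ⟨ρ, hρ⟩
  have hcont : Continuous fun π : FiniteMeasure (Euc d × Euc d) =>
      ∫ p, F p ∂(π : Measure (Euc d × Euc d)) :=
    FiniteMeasure.continuous_integral_boundedContinuousFunction F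
  obtain ⟨π, hπS, hmin⟩ := hS.exists_isMinOn hSne hcont.continuousOn
  refine ⟨π, hπS.2, fun π' hπ' => ?_⟩
  rw [hcost _ hπS.2, hcost _ hπ']
  obtain ⟨ρ, hρ, hρe⟩ := hmem π' hπ'
  have h1 : ∫ p, F p ∂(π : Measure (Euc d × Euc d)) ≤ ∫ p, F p ∂(ρ : Measure (Euc d × Euc d)) :=
    hmin hρ
  rw [hρe] at h1
  have hBm : MeasurableSet (frontier Ω ×ˢ frontier Ω) :=
    isClosed_frontier.measurableSet.prod isClosed_frontier.measurableSet
  have := hπ'.1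
  have h2 := integral_add_compl hBm (F.integrable π')
  have h3 : 0 ≤ ∫ p in frontier Ω ×ˢ frontier Ω, F p ∂π' := by
    refine setIntegral_nonneg hBm fun p hp => ?_
    have a1 := noarb p.1 hp.1 p.2 hp.2
    have a2 := hC p ⟨hcl.frontier_subset hp.1, hcl.frontier_subset hp.2⟩
    have a3 := hP p.1 hp.1
    have a4 := hM p.2 hp.2
    change 0 ≤ C p + P p.1 - M p.2
    rw [a2, a3, a4]; linarith
  linarith
end
end

section
/- The value function H(h⁺,h⁻) := −sup{∫_Ω φ⁻ dμ⁻ − ∫_Ω φ⁺ dμ⁺ : ψ⁻ + h⁻ ≤ φ⁻ ≤ φ⁺ ≤ ψ⁺ − h⁺ on ∂Ω, φ⁻(y) − φ⁺(x) ≤ c(x,y)} defined on C(∂Ω) × C(∂Ω) is convex and lower semi-continuous (with values in ℝ ∪ {+∞}) with respect to uniform convergence. -/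
open MeasureTheory Set

noncomputable section

variable {d : ℕ}

/-- The perturbed dual value functional `H(h⁺,h⁻)` from the duality proof, with values in
`EReal` (the value is `+∞ = -sSup ∅` when the feasible set is empty). -/
def Hfun (Ω : Set (Euc d)) (c : Euc d → Euc d → ℝ) (ψp ψm : Euc d → ℝ)
    (μp μm : Measure (Euc d))
    (h : C((frontier Ω : Set (Euc d)), ℝ) × C((frontier Ω : Set (Euc d)), ℝ)) : EReal :=
  - sSup {r : EReal | ∃ φp φm : Euc d → ℝ, ContinuousOn φp Ω ∧ ContinuousOn φm Ω ∧
      (∀ x : (frontier Ω : Set (Euc d)),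
        ψm x + h.2 x ≤ φm x ∧ φm (x : Euc d) ≤ φp x ∧ φp (x : Euc d) ≤ ψp x - h.1 x) ∧
      (∀ x ∈ Ω, ∀ y ∈ Ω, φm y - φp x ≤ c x y) ∧
      r = (((∫ y, φm y ∂μm) - ∫ x, φp x ∂μp : ℝ) : EReal)}


open Filter Topology
open scoped BoundedContinuousFunction

/-- Relaxed feasibility with value at most `b`. -/
def RelFeas (Ω : Set (Euc d)) (c : Euc d → Euc d → ℝ) (K : NNReal) (ψp ψm : Euc d → ℝ)
    (μp μm : Measure (Euc d))
    (h : C((frontier Ω : Set (Euc d)), ℝ) × C((frontier Ω : Set (Euc d)), ℝ)) (b : ℝ)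
    (f g : Ω →ᵇ ℝ) : Prop :=
  (∀ x y, f x - f y ≤ K * dist x y) ∧ (∀ x y, g x - g y ≤ K * dist x y) ∧
  (∀ x y : Ω, f y - g x ≤ c x y) ∧
  (∀ (x : Ω) (hx : (x : Euc d) ∈ frontier Ω), ψm x + h.2 ⟨x, hx⟩ ≤ f x ∧
    g x ≤ ψp x - h.1 ⟨x, hx⟩ ∧ ψm x + h.2 ⟨x, hx⟩ ≤ ψp x - h.1 ⟨x, hx⟩) ∧
  (∫ x, g x ∂(μp.comap Subtype.val)) - (∫ x, f x ∂(μm.comap Subtype.val)) ≤ b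

theorem lip_bcf {X : Type*} [PseudoMetricSpace X] [CompactSpace X] (K : NNReal) (f : X → ℝ)
    (hf : ∀ x y, f x - f y ≤ K * dist x y) : ∃ F : X →ᵇ ℝ, ∀ x, F x = f x := by
  have hL : LipschitzWith K f := by
    apply LipschitzWith.of_dist_le_mul
    intro x y
    rw [Real.dist_eq, abs_le]
    have h1 := hf x y
    have h2 := hf y x
    rw [dist_comm] at h2
    constructor <;> linarith
  exact ⟨BoundedContinuousFunction.mkOfCompact ⟨f, hL.continuous⟩, fun x => rfl⟩

theorem transform {X : Type*} [PseudoMetricSpace X] [CompactSpace X] [Nonempty X] (K : NNReal)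
    (c : X → X → ℝ) (h1 : ∀ x x' y, c x y - c x' y ≤ K * dist x x')
    (h2 : ∀ x y y', c x y - c x y' ≤ K * dist y y') (φ χ : X → ℝ) 
    (hle : ∀ x y, χ y - φ x ≤ c x y) :
    ∃ f g : X →ᵇ ℝ, (∀ x y, f x - f y ≤ K * dist x y) ∧ (∀ x y, g x - g y ≤ K * dist x y) ∧
      (∀ x y, f y - g x ≤ c x y) ∧ (∀ x, χ x ≤ f x) ∧ (∀ x, g x ≤ φ x) := by
  have hX : IsCompact (univ : Set X) := isCompact_univ
  obtain ⟨x0⟩ := ‹Nonempty X›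
  have : Nonempty X := ⟨x0⟩
  have hb1 : ∀ y, BddBelow (range fun x => c x y + φ x) := by
    intro y
    refine ⟨χ y, ?_⟩
    rintro _ ⟨x, rfl⟩
    have := hle x y
    dsimp only
    linarith
  have hf : ∀ y y', (⨅ x, (c x y + φ x)) - (⨅ x, (c x y' + φ x)) ≤ K * dist y y' := by
    intro y y'
    have : (⨅ x, (c x y + φ x)) - K * dist y y' ≤ ⨅ x, (c x y' + φ x) := by
      apply le_ciInf
      intro x
      have := ciInf_le (hb1 y) x
      have := h2 x y y'
      linarith
    linarith
  obtain ⟨f, hfe⟩ := lip_bcf K _ hf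
  have hfc : ∀ x y, f y - c x y ≤ φ x := by
    intro x y
    rw [hfe]
    have := ciInf_le (hb1 y) x
    linarith
  have hb2 : ∀ x, BddAbove (range fun y => f y - c x y) := by
    intro x
    refine ⟨φ x, ?_⟩
    rintro _ ⟨y, rfl⟩
    exact hfc x y
  have hg : ∀ x x', (⨆ y, (f y - c x y)) - (⨆ y, (f y - c x' y)) ≤ K * dist x x' := by
    intro x x'
    have : (⨆ y, (f y - c x y)) ≤ (⨆ y, (f y - c x' y)) + K * dist x x' := by
      apply ciSup_le
      intro y
      have := le_ciSup (hb2 x') y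
      have := h1 x' x y
      rw [dist_comm] at this
      linarith
    linarith
  obtain ⟨g, hge⟩ := lip_bcf K _ hg
  refine ⟨f, g, ?_, ?_, ?_, ?_, ?_⟩
  · intro x y; rw [hfe, hfe]; exact hf x y
  · intro x y; rw [hge, hge]; exact hg x y
  · intro x y
    rw [hge]
    have := le_ciSup (hb2 x) y
    linarith
  · intro y
    rw [hfe]
    apply le_ciInf
    intro x
    have := hle x y
    linarith
  · intro x
    rw [hge]
    exact ciSup_le (hfc x)

theorem restr_eq {Ω : Set (Euc d)} {μ : Measure (Euc d)} (hμ : μ (interior Ω)ᶜ = 0) :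
    μ.restrict Ω = μ := by
  apply Measure.restrict_eq_self_of_ae_mem
  have : ∀ᵐ x ∂μ, x ∈ interior Ω := hμ
  filter_upwards [this] with x hx using interior_subset hx

theorem int_eq {Ω : Set (Euc d)} (hΩ : IsCompact Ω) {μ : Measure (Euc d)}
    (hμ : μ (interior Ω)ᶜ = 0) (F : Euc d → ℝ) :
    ∫ x, F x ∂μ = ∫ x : Ω, F x ∂(μ.comap Subtype.val) := by
  rw [integral_subtype_comap hΩ.isClosed.measurableSet, restr_eq hμ]

theorem fin_comap {Ω : Set (Euc d)} (_hΩ : IsCompact Ω) (μ : Measure (Euc d))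
    [IsFiniteMeasure μ] : IsFiniteMeasure (μ.comap (Subtype.val : Ω → Euc d)) :=
  inferInstance

theorem lemA (Ω : Set (Euc d)) (hΩ : IsCompact Ω) (hΩne : Ω.Nonempty)
    (c : Euc d → Euc d → ℝ) (K : NNReal)
    (hc : LipschitzOnWith K (fun p : Euc d × Euc d => c p.1 p.2) (Ω ×ˢ Ω))
    (ψp ψm : Euc d → ℝ)
    (μp μm : Measure (Euc d)) [IsFiniteMeasure μp] [IsFiniteMeasure μm]
    (hμp : μp (interior Ω)ᶜ = 0) (hμm : μm (interior Ω)ᶜ = 0)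
    (h : C((frontier Ω : Set (Euc d)), ℝ) × C((frontier Ω : Set (Euc d)), ℝ)) (b : ℝ)
    (hb : Hfun Ω c ψp ψm μp μm h < b) : ∃ f g, RelFeas Ω c K ψp ψm μp μm h b f g := by
  have := isCompact_iff_compactSpace.1 hΩ
  have : Nonempty Ω := hΩne.to_subtype
  have := fin_comap hΩ μp
  have := fin_comap hΩ μm
  unfold Hfun at hb
  rw [EReal.neg_lt_comm, lt_sSup_iff] at hb
  obtain ⟨r, ⟨φp, φm, hp, hm, hbd, hle, rfl⟩, hr⟩ := hb
  have hr' : -b < (∫ y, φm y ∂μm) - ∫ x, φp x ∂μp := by exact_mod_cast hr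
  have hcc : ∀ x x' y y' : Ω, c x y - c x' y' ≤ K * max (dist x x') (dist y y') := by
    intro x x' y y'
    have := hc.dist_le_mul ((x : Euc d), (y : Euc d)) ⟨x.2, y.2⟩
      ((x' : Euc d), (y' : Euc d)) ⟨x'.2, y'.2⟩
    rw [Real.dist_eq, Prod.dist_eq] at this
    exact (le_abs_self _).trans this
  have hp' := continuousOn_iff_continuous_domRestrict.1 hp
  have hm' := continuousOn_iff_continuous_domRestrict.1 hm
  obtain ⟨f, g, hf, hg, hfg, hχ, hφ⟩ := transform (X := Ω) K (fun x y => c x y)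
    (fun x x' y => by simpa using hcc x x' y y) (fun x y y' => by simpa using hcc x x y y')
    (Ω.domRestrict φp) (Ω.domRestrict φm) (fun x y => hle x x.2 y y.2)
  refine ⟨f, g, hf, hg, hfg, ?_, ?_⟩
  · intro x hx
    obtain ⟨h1, h2, h3⟩ := hbd ⟨x, hx⟩
    have := hχ x
    have := hφ x
    simp only [domRestrict_apply] at *
    exact ⟨by linarith, by linarith, by linarith⟩
  · rw [int_eq hΩ hμp, int_eq hΩ hμm] at hr'
    have i1 := integral_mono (μ := μp.comap Subtype.val) (g.integrable _)
      ((BoundedContinuousFunction.mkOfCompact ⟨_, hp'⟩).integrable _) hφ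
    have i2 := integral_mono (μ := μm.comap Subtype.val)
      ((BoundedContinuousFunction.mkOfCompact ⟨_, hm'⟩).integrable _) (f.integrable _) hχ
    simp only [BoundedContinuousFunction.mkOfCompact_apply, ContinuousMap.coe_mk,
      domRestrict_apply] at i1 i2
    linarith

theorem layer {Ω : Set (Euc d)} (hΩ : IsCompact Ω) (hfr : (frontier Ω).Nonempty)
    {μ : Measure (Euc d)} [IsFiniteMeasure μ]
    (hμ : μ (interior Ω)ᶜ = 0) (U : C(Euc d, ℝ)) :
    Tendsto (fun n : ℕ => ∫ x, max 0 (1 - n * Metric.infDist x (frontier Ω)) * U x ∂μ) atTop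
      (𝓝 0) := by
  have key : Tendsto (fun n : ℕ => ∫ x, max 0 (1 - n * Metric.infDist x (frontier Ω)) * U x ∂μ)
      atTop (𝓝 (∫ x, 0 ∂μ)) := by
    apply tendsto_integral_of_dominated_convergence (fun x => |U x|)
    · intro n
      apply Continuous.aestronglyMeasurable
      have := Metric.continuous_infDist_pt (frontier Ω)
      fun_prop
    · have := (U.continuous.abs.continuousOn (s := Ω)).integrableOn_compact (μ := μ) hΩ
      rwa [IntegrableOn, restr_eq hμ] at this
    · intro n
      refine Eventually.of_forall fun x => ?_
      rw [norm_mul, Real.norm_eq_abs, Real.norm_eq_abs]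
      have h0 : (0:ℝ) ≤ n * Metric.infDist x (frontier Ω) :=
        mul_nonneg (Nat.cast_nonneg _) Metric.infDist_nonneg
      rw [abs_of_nonneg (le_max_left _ _)]
      apply mul_le_of_le_one_left (abs_nonneg _)
      apply max_le <;> linarith
    · have : ∀ᵐ x ∂μ, x ∈ interior Ω := hμ
      filter_upwards [this] with x hx
      have hx' : x ∉ frontier Ω := fun h => h.2 hx
      have hpos : 0 < Metric.infDist x (frontier Ω) :=
        (isClosed_frontier.notMem_iff_infDist_pos hfr).1 hx'
      apply tendsto_const_nhds.congr'
      obtain ⟨N, hN⟩ := exists_nat_gt (1 / Metric.infDist x (frontier Ω))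
      filter_upwards [eventually_ge_atTop N] with n hn
      have : (N : ℝ) ≤ n := by exact_mod_cast hn
      rw [div_lt_iff₀ hpos] at hN
      have : (N:ℝ) * Metric.infDist x (frontier Ω) ≤ n * Metric.infDist x (frontier Ω) := by
        gcongr
      rw [max_eq_left (by linarith), zero_mul]
  simpa using key

theorem bdry_arith {p f g q : ℝ} (b1 : p ≤ f) (b2 : g ≤ q) (b3 : p ≤ q) :
    p ≤ f - max 0 (f - max g p) ∧ f - max 0 (f - max g p) ≤ g + max 0 (p - g) ∧
      g + max 0 (p - g) ≤ q := by
  refine ⟨?_, ?_, ?_⟩ <;> rcases max_cases g p with ⟨h1, _⟩ | ⟨h1, _⟩ <;>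
    rcases max_cases 0 (f - max g p) with ⟨h2, _⟩ | ⟨h2, _⟩ <;>
    rcases max_cases 0 (p - g) with ⟨h3, _⟩ | ⟨h3, _⟩ <;> rw [h1] at * <;> linarith

theorem lemB (Ω : Set (Euc d)) (hΩ : IsCompact Ω) (hfr : (frontier Ω).Nonempty)
    (c : Euc d → Euc d → ℝ) (K : NNReal)
    (ψp ψm : Euc d → ℝ) (hψm : ContinuousOn ψm (frontier Ω))
    (μp μm : Measure (Euc d)) [IsFiniteMeasure μp] [IsFiniteMeasure μm]
    (hμp : μp (interior Ω)ᶜ = 0) (hμm : μm (interior Ω)ᶜ = 0)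
    (h : C((frontier Ω : Set (Euc d)), ℝ) × C((frontier Ω : Set (Euc d)), ℝ)) (b : ℝ)
    (f g : Ω →ᵇ ℝ) (hR : RelFeas Ω c K ψp ψm μp μm h b f g) :
    Hfun Ω c ψp ψm μp μm h ≤ b := by
  obtain ⟨-, -, hfg, hbd, hV⟩ := hR
  have hsub : frontier Ω ⊆ Ω := hΩ.isClosed.frontier_subset
  obtain ⟨F, hF⟩ := ContinuousMap.exists_restrict_eq hΩ.isClosed f.toContinuousMap
  obtain ⟨G, hG⟩ := ContinuousMap.exists_restrict_eq hΩ.isClosed g.toContinuousMap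
  have hF' : ∀ x : Ω, F x = f x := fun x => DFunLike.congr_fun hF x
  have hG' : ∀ x : Ω, G x = g x := fun x => DFunLike.congr_fun hG x
  obtain ⟨P, hP⟩ := ContinuousMap.exists_restrict_eq (isClosed_frontier (s := Ω))
    (⟨_, continuousOn_iff_continuous_domRestrict.1 hψm⟩ + h.2)
  have hP' : ∀ x : frontier Ω, P x = ψm x + h.2 x := fun x => DFunLike.congr_fun hP x
  let U : C(Euc d, ℝ) := ⟨fun x => max 0 (P x - G x), by fun_prop⟩
  let W : C(Euc d, ℝ) := ⟨fun x => max 0 (F x - max (G x) (P x)), by fun_prop⟩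
  have hU0 : ∀ x, 0 ≤ U x := fun x => le_max_left _ _
  have hW0 : ∀ x, 0 ≤ W x := fun x => le_max_left _ _
  let χ : ℕ → Euc d → ℝ := fun n x => max 0 (1 - n * Metric.infDist x (frontier Ω))
  have hχ0 : ∀ n x, 0 ≤ χ n x := fun n x => le_max_left _ _
  have hχc : ∀ n, Continuous (χ n) := by
    intro n
    have := Metric.continuous_infDist_pt (frontier Ω)
    fun_prop
  have hint : ∀ (μ : Measure (Euc d)) [IsFiniteMeasure μ], μ (interior Ω)ᶜ = 0 →
      ∀ V : Euc d → ℝ, Continuous V → Integrable V μ := by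
    intro μ _ hμ V hVc
    have := (hVc.continuousOn (s := Ω)).integrableOn_compact (μ := μ) hΩ
    rwa [IntegrableOn, restr_eq hμ] at this
  have hn : ∀ n, Hfun Ω c ψp ψm μp μm h ≤
      (((∫ x, G x ∂μp) + (∫ x, χ n x * U x ∂μp) - ((∫ x, F x ∂μm) - ∫ x, χ n x * W x ∂μm) : ℝ)
        : EReal) := by
    intro n
    unfold Hfun
    rw [EReal.neg_le]
    apply le_sSup
    refine ⟨fun x => G x + χ n x * U x, fun x => F x - χ n x * W x, ?_, ?_, ?_, ?_, ?_⟩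
    · have := hχc n
      fun_prop
    · have := hχc n
      fun_prop
    · intro x
      have h1 : χ n x = 1 := by simp [χ, Metric.infDist_zero_of_mem x.2]
      obtain ⟨b1, b2, b3⟩ := hbd ⟨x, hsub x.2⟩ x.2
      have e1 := hP' x
      have e2 := hF' ⟨x, hsub x.2⟩
      have e3 := hG' ⟨x, hsub x.2⟩
      simp only [Subtype.coe_eta] at b1 b2 b3 e2 e3
      rw [← e1] at b1 b3
      rw [← e2] at b1
      rw [← e3] at b2
      simp only [h1, one_mul, U, W, ContinuousMap.coe_mk]
      rw [← e1]
      exact bdry_arith b1 b2 b3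
    · intro x hx y hy
      have h1 := hfg ⟨x, hx⟩ ⟨y, hy⟩
      rw [← hF', ← hG'] at h1
      have := mul_nonneg (hχ0 n x) (hU0 x)
      have := mul_nonneg (hχ0 n y) (hW0 y)
      simp only at h1 ⊢
      linarith
    · rw [← EReal.coe_neg, integral_add, integral_sub, neg_sub]
      · exact hint _ hμm _ F.continuous
      · exact hint _ hμm _ ((hχc n).mul W.continuous)
      · exact hint _ hμp _ G.continuous
      · exact hint _ hμp _ ((hχc n).mul U.continuous)
  have hlim : Tendsto (fun n => (∫ x, G x ∂μp) + (∫ x, χ n x * U x ∂μp) -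
      ((∫ x, F x ∂μm) - ∫ x, χ n x * W x ∂μm)) atTop
      (𝓝 ((∫ x, G x ∂μp) + 0 - ((∫ x, F x ∂μm) - 0))) :=
    (tendsto_const_nhds.add (layer hΩ hfr hμp U)).sub
      (tendsto_const_nhds.sub (layer hΩ hfr hμm W))
  have := ge_of_tendsto' ((continuous_coe_real_ereal.tendsto _).comp hlim) hn
  refine this.trans ?_
  rw [EReal.coe_le_coe_iff, int_eq hΩ hμp, int_eq hΩ hμm]
  simp only [hF', hG']
  linarith

/-- A priori bounds. -/
theorem bounds (Ω : Set (Euc d)) (hΩ : IsCompact Ω) (hfr : (frontier Ω).Nonempty)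
    (c : Euc d → Euc d → ℝ) (K : NNReal)
    (hc : LipschitzOnWith K (fun p : Euc d × Euc d => c p.1 p.2) (Ω ×ˢ Ω))
    [CompactSpace (frontier Ω)]
    (ψp ψm : Euc d → ℝ) (μp μm : Measure (Euc d)) (R : ℝ) :
    ∃ M : ℝ, ∀ (h : C((frontier Ω : Set (Euc d)), ℝ) × C((frontier Ω : Set (Euc d)), ℝ)) (b : ℝ)
      (f g : Ω →ᵇ ℝ), ‖h‖ ≤ R → RelFeas Ω c K ψp ψm μp μm h b f g →
        (∀ x, |f x| ≤ M) ∧ (∀ x, |g x| ≤ M) := by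
  have := isCompact_iff_compactSpace.1 hΩ
  have hsub : frontier Ω ⊆ Ω := hΩ.isClosed.frontier_subset
  have : CompactSpace (frontier Ω) :=
    isCompact_iff_compactSpace.1 (hΩ.of_isClosed_subset isClosed_frontier hsub)
  obtain ⟨x0, hx0⟩ := hfr
  obtain ⟨C, hC⟩ := (hΩ.prod hΩ).exists_bound_of_continuousOn hc.continuousOn
  let D := Metric.diam (univ : Set Ω)
  have hD : ∀ x y : Ω, (K : ℝ) * dist x y ≤ K * D := fun x y => by
    gcongr
    exact Metric.dist_le_diam_of_mem isCompact_univ.isBounded (mem_univ _) (mem_univ _)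
  refine ⟨|C| + |ψp x0| + |ψm x0| + |R| + K * D, ?_⟩
  rintro h b f g hh ⟨hf, hg, hfg, hbd, -⟩
  let z : Ω := ⟨x0, hsub hx0⟩
  obtain ⟨b1, b2, -⟩ := hbd z hx0
  have n1 := (h.1.norm_coe_le_norm ⟨x0, hx0⟩).trans ((norm_fst_le h).trans hh)
  have n2 := (h.2.norm_coe_le_norm ⟨x0, hx0⟩).trans ((norm_snd_le h).trans hh)
  rw [Real.norm_eq_abs, abs_le] at n1 n2
  have a1 := le_abs_self C
  have a2 := abs_le.1 (le_refl |ψp x0|)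
  have a3 := abs_le.1 (le_refl |ψm x0|)
  have a4 := le_abs_self R
  have hcz : ∀ x y : Ω, |c x y| ≤ C := fun x y => hC (x, y) ⟨x.2, y.2⟩
  have hK : 0 ≤ K * D := by have := hD z z; rwa [dist_self, mul_zero] at this
  have hz : (z : Euc d) = x0 := rfl
  simp only [hz] at b1 b2
  constructor
  · intro x
    have c1 := abs_le.1 (hcz z x)
    have := hfg z x
    have := hf z x
    have := hD z x
    rw [abs_le]
    constructor <;> linarith
  · intro x
    have c1 := abs_le.1 (hcz x z)
    have := hfg x z
    have := hg x z
    have := hD x z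
    rw [abs_le]
    constructor <;> linarith

theorem compactness {X : Type*} [PseudoMetricSpace X] [CompactSpace X] (K : NNReal) (M : ℝ) :
    IsCompact {f : X →ᵇ ℝ | (∀ x y, f x - f y ≤ K * dist x y) ∧ ∀ x, |f x| ≤ M} := by
  have hev : ∀ x : X, Continuous fun f : X →ᵇ ℝ => f x :=
    fun x => continuous_eval_const x
  apply BoundedContinuousFunction.arzela_ascoli₂ (Icc (-M) M) isCompact_Icc
  · simp only [ofPred_and, ofPred_forall]
    apply IsClosed.inter
    · refine isClosed_iInter fun x => isClosed_iInter fun y => ?_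
      exact isClosed_le ((hev x).sub (hev y)) continuous_const
    · refine isClosed_iInter fun x => ?_
      exact isClosed_le (hev x).abs continuous_const
  · rintro f x ⟨-, hf⟩
    exact abs_le.1 (hf x)
  · apply Metric.equicontinuous_of_continuity_modulus (fun t => K * t)
    · have : Continuous fun t : ℝ => (K : ℝ) * t := by fun_prop
      simpa using this.tendsto 0
    · rintro x y ⟨f, hf, -⟩
      have h1 := hf x y
      have h2 := hf y x
      rw [dist_comm] at h2
      simp only [Real.dist_eq]
      rw [abs_le]
      constructor <;> linarith

theorem cont_int {X : Type*} [PseudoMetricSpace X] [MeasurableSpace X] [BorelSpace X]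
    [SecondCountableTopology X] (μ : Measure X) [IsFiniteMeasure μ] :
    Continuous fun f : X →ᵇ ℝ => ∫ x, f x ∂μ := by
  rw [continuous_iff_seqContinuous]
  intro u f hu
  have hev : ∀ x : X, Continuous fun f : X →ᵇ ℝ => f x :=
    fun x => continuous_eval_const x
  obtain ⟨B, hB⟩ := (Metric.isBounded_range_of_tendsto u hu).exists_norm_le
  apply tendsto_integral_of_dominated_convergence (fun _ => B)
  · intro n
    exact (u n).continuous.aestronglyMeasurable
  · exact integrable_const B
  · intro n
    exact Eventually.of_forall fun x => ((u n).norm_coe_le_norm x).trans (hB _ ⟨n, rfl⟩)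
  · exact Eventually.of_forall fun x => ((hev x).tendsto f).comp hu

theorem rel_closed (Ω : Set (Euc d)) (hΩ : IsCompact Ω) 
    (c : Euc d → Euc d → ℝ) (K : NNReal)
    (ψp ψm : Euc d → ℝ) (μp μm : Measure (Euc d)) [IsFiniteMeasure μp] [IsFiniteMeasure μm]
    (b : ℝ) :
    IsClosed {q : (C((frontier Ω : Set (Euc d)), ℝ) × C((frontier Ω : Set (Euc d)), ℝ)) ×
      ((Ω →ᵇ ℝ) × (Ω →ᵇ ℝ)) | RelFeas Ω c K ψp ψm μp μm q.1 b q.2.1 q.2.2} := by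
  have := fin_comap hΩ μp
  have := fin_comap hΩ μm
  have hev : ∀ x : Ω, Continuous fun f : Ω →ᵇ ℝ => f x :=
    fun x => continuous_eval_const x
  have e1 : ∀ x : Ω, Continuous fun q : (C((frontier Ω : Set (Euc d)), ℝ) ×
      C((frontier Ω : Set (Euc d)), ℝ)) × ((Ω →ᵇ ℝ) × (Ω →ᵇ ℝ)) => q.2.1 x :=
    fun x => (hev x).comp (continuous_fst.comp continuous_snd)
  have e2 : ∀ x : Ω, Continuous fun q : (C((frontier Ω : Set (Euc d)), ℝ) ×
      C((frontier Ω : Set (Euc d)), ℝ)) × ((Ω →ᵇ ℝ) × (Ω →ᵇ ℝ)) => q.2.2 x :=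
    fun x => (hev x).comp (continuous_snd.comp continuous_snd)
  have e3 : ∀ x : frontier Ω, Continuous fun q : (C((frontier Ω : Set (Euc d)), ℝ) ×
      C((frontier Ω : Set (Euc d)), ℝ)) × ((Ω →ᵇ ℝ) × (Ω →ᵇ ℝ)) => q.1.1 x :=
    fun x => (continuous_eval_const x).comp (continuous_fst.comp continuous_fst)
  have e4 : ∀ x : frontier Ω, Continuous fun q : (C((frontier Ω : Set (Euc d)), ℝ) ×
      C((frontier Ω : Set (Euc d)), ℝ)) × ((Ω →ᵇ ℝ) × (Ω →ᵇ ℝ)) => q.1.2 x :=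
    fun x => (continuous_eval_const x).comp (continuous_snd.comp continuous_fst)
  have i1 := (cont_int (X := Ω) (μm.comap Subtype.val)).comp
    ((continuous_fst (X := Ω →ᵇ ℝ) (Y := Ω →ᵇ ℝ)).comp (continuous_snd
      (X := C((frontier Ω : Set (Euc d)), ℝ) × C((frontier Ω : Set (Euc d)), ℝ))))
  have i2 := (cont_int (X := Ω) (μp.comap Subtype.val)).comp
    ((continuous_snd (X := Ω →ᵇ ℝ) (Y := Ω →ᵇ ℝ)).comp (continuous_snd
      (X := C((frontier Ω : Set (Euc d)), ℝ) × C((frontier Ω : Set (Euc d)), ℝ))))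
  unfold RelFeas
  simp only [ofPred_and, ofPred_forall]
  refine IsClosed.inter ?_ (IsClosed.inter ?_ (IsClosed.inter ?_ (IsClosed.inter ?_ ?_)))
  · exact isClosed_iInter fun x => isClosed_iInter fun y =>
      isClosed_le ((e1 x).sub (e1 y)) continuous_const
  · exact isClosed_iInter fun x => isClosed_iInter fun y =>
      isClosed_le ((e2 x).sub (e2 y)) continuous_const
  · exact isClosed_iInter fun x => isClosed_iInter fun y =>
      isClosed_le ((e1 y).sub (e2 x)) continuous_const
  · refine isClosed_iInter fun x => isClosed_iInter fun hx => ?_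
    refine IsClosed.inter ?_ (IsClosed.inter ?_ ?_)
    · exact isClosed_le (continuous_const.add (e4 _)) (e1 x)
    · exact isClosed_le (e2 x) (continuous_const.sub (e3 _))
    · exact isClosed_le (continuous_const.add (e4 _)) (continuous_const.sub (e3 _))
  · exact isClosed_le (i2.sub i1) continuous_const

theorem rel_convex (Ω : Set (Euc d)) (hΩ : IsCompact Ω) 
    (c : Euc d → Euc d → ℝ) (K : NNReal)
    (ψp ψm : Euc d → ℝ) (μp μm : Measure (Euc d)) [IsFiniteMeasure μp] [IsFiniteMeasure μm]
    (h h' : C((frontier Ω : Set (Euc d)), ℝ) × C((frontier Ω : Set (Euc d)), ℝ))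
    (b b' t : ℝ) (ht : 0 ≤ t) (ht' : 0 ≤ 1 - t) (f g f' g' : Ω →ᵇ ℝ)
    (hR : RelFeas Ω c K ψp ψm μp μm h b f g) (hR' : RelFeas Ω c K ψp ψm μp μm h' b' f' g') :
    RelFeas Ω c K ψp ψm μp μm (t • h + (1 - t) • h') (t * b + (1 - t) * b')
      (t • f + (1 - t) • f') (t • g + (1 - t) • g') := by
  have := fin_comap hΩ μp
  have := fin_comap hΩ μm
  obtain ⟨h1, h2, h3, h4, h5⟩ := hR
  obtain ⟨k1, k2, k3, k4, k5⟩ := hR'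
  refine ⟨?_, ?_, ?_, ?_, ?_⟩
  · intro x y
    have a := mul_le_mul_of_nonneg_left (h1 x y) ht
    have a' := mul_le_mul_of_nonneg_left (k1 x y) ht'
    simp only [BoundedContinuousFunction.coe_add, BoundedContinuousFunction.coe_smul,
      Pi.add_apply, smul_eq_mul]
    linarith
  · intro x y
    have a := mul_le_mul_of_nonneg_left (h2 x y) ht
    have a' := mul_le_mul_of_nonneg_left (k2 x y) ht'
    simp only [BoundedContinuousFunction.coe_add, BoundedContinuousFunction.coe_smul,
      Pi.add_apply, smul_eq_mul]
    linarith
  · intro x y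
    have a := mul_le_mul_of_nonneg_left (h3 x y) ht
    have a' := mul_le_mul_of_nonneg_left (k3 x y) ht'
    simp only [BoundedContinuousFunction.coe_add, BoundedContinuousFunction.coe_smul,
      Pi.add_apply, smul_eq_mul]
    linarith
  · intro x hx
    obtain ⟨p1, p2, p3⟩ := h4 x hx
    obtain ⟨q1, q2, q3⟩ := k4 x hx
    have a1 := mul_le_mul_of_nonneg_left p1 ht
    have a2 := mul_le_mul_of_nonneg_left p2 ht
    have a3 := mul_le_mul_of_nonneg_left p3 ht
    have b1 := mul_le_mul_of_nonneg_left q1 ht'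
    have b2 := mul_le_mul_of_nonneg_left q2 ht'
    have b3 := mul_le_mul_of_nonneg_left q3 ht'
    simp only [BoundedContinuousFunction.coe_add, BoundedContinuousFunction.coe_smul,
      Pi.add_apply, smul_eq_mul, Prod.fst_add, Prod.snd_add, Prod.smul_fst, Prod.smul_snd,
      ContinuousMap.coe_add, ContinuousMap.coe_smul, Pi.smul_apply]
    refine ⟨?_, ?_, ?_⟩ <;> linarith
  · have a := mul_le_mul_of_nonneg_left h5 ht
    have a' := mul_le_mul_of_nonneg_left k5 ht'
    simp only [BoundedContinuousFunction.coe_add, BoundedContinuousFunction.coe_smul,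
      Pi.add_apply, smul_eq_mul]
    rw [integral_add ((g.integrable _).const_mul t) ((g'.integrable _).const_mul _),
      integral_add ((f.integrable _).const_mul t) ((f'.integrable _).const_mul _)]
    simp only [integral_const_mul]
    linarith

/-- the functional `H` is convex and lower semi-continuous on
`C(∂Ω) × C(∂Ω)` and never takes the value `-∞`. -/
theorem Hfun_convex_lsc (Ω : Set (Euc d)) (hΩ : IsCompact Ω)
    (hΩne : Ω.Nonempty) (hfr : (frontier Ω).Nonempty)
    (c : Euc d → Euc d → ℝ) (K : NNReal)
    (hc : LipschitzOnWith K (fun p : Euc d × Euc d => c p.1 p.2) (Ω ×ˢ Ω))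
    (ψp ψm : Euc d → ℝ)
    (hψp : ContinuousOn ψp (frontier Ω)) (hψm : ContinuousOn ψm (frontier Ω))
    (μp μm : Measure (Euc d)) [IsFiniteMeasure μp] [IsFiniteMeasure μm]
    (hμp : μp (interior Ω)ᶜ = 0) (hμm : μm (interior Ω)ᶜ = 0) :
    (∀ a b : C((frontier Ω : Set (Euc d)), ℝ) × C((frontier Ω : Set (Euc d)), ℝ),
      ∀ t ∈ Icc (0 : ℝ) 1,
        Hfun Ω c ψp ψm μp μm (t • a + (1 - t) • b) ≤
          (t : EReal) * Hfun Ω c ψp ψm μp μm a +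
            ((1 - t : ℝ) : EReal) * Hfun Ω c ψp ψm μp μm b) ∧
    LowerSemicontinuous (Hfun Ω c ψp ψm μp μm) ∧
    (∀ h, Hfun Ω c ψp ψm μp μm h ≠ ⊥) := by
  have A := lemA Ω hΩ hΩne c K hc ψp ψm μp μm hμp hμm
  have B := lemB Ω hΩ hfr c K ψp ψm hψm μp μm hμp hμm
  have hcs := isCompact_iff_compactSpace.1 hΩ
  have hcf : CompactSpace (frontier Ω) := isCompact_iff_compactSpace.1
    (hΩ.of_isClosed_subset isClosed_frontier hΩ.isClosed.frontier_subset)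
  have := fin_comap hΩ μp
  have := fin_comap hΩ μm
  have hbot : ∀ h, Hfun Ω c ψp ψm μp μm h ≠ ⊥ := by
    intro h hh
    obtain ⟨M, hM⟩ := bounds Ω hΩ hfr c K hc ψp ψm μp μm ‖h‖
    let ν1 : Measure Ω := μp.comap Subtype.val
    let ν2 : Measure Ω := μm.comap Subtype.val
    obtain ⟨f, g, hR⟩ := A h (-M * ν1.real univ - M * ν2.real univ - 1) (by
      rw [hh]; exact EReal.bot_lt_coe _)
    obtain ⟨m1, m2⟩ := hM h _ f g le_rfl hR
    have j1 : ∫ x, (-M) ∂ν1 ≤ ∫ x, g x ∂ν1 := integral_mono (integrable_const _)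
      (g.integrable _) (fun x => (abs_le.1 (m2 x)).1)
    have j2 : ∫ x, f x ∂ν2 ≤ ∫ x, M ∂ν2 := integral_mono (f.integrable _)
      (integrable_const _) (fun x => (abs_le.1 (m1 x)).2)
    have := hR.2.2.2.2
    rw [integral_const, smul_eq_mul] at j1 j2
    change (∫ x, g x ∂ν1) - (∫ x, f x ∂ν2) ≤ _ at this
    linarith
  refine ⟨?_, ?_, hbot⟩
  · rintro a b t ⟨ht0, ht1⟩
    rcases ht0.eq_or_lt with rfl | ht0
    · simp
    rcases ht1.eq_or_lt with rfl | ht1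
    · simp
    have ht2 : 0 < 1 - t := by linarith
    by_cases ha : Hfun Ω c ψp ψm μp μm a = ⊤
    · rw [ha, EReal.coe_mul_top_of_pos ht0, EReal.top_add_of_ne_bot]
      · exact le_top
      · have := hbot b
        generalize Hfun Ω c ψp ψm μp μm b = y at *
        induction y with
        | bot => exact absurd rfl this
        | coe y => rw [← EReal.coe_mul]; exact EReal.coe_ne_bot _
        | top => rw [EReal.coe_mul_top_of_pos ht2]; exact top_ne_bot
    by_cases hb : Hfun Ω c ψp ψm μp μm b = ⊤
    · rw [hb, EReal.coe_mul_top_of_pos ht2, EReal.add_top_of_ne_bot]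
      · exact le_top
      · have := hbot a
        generalize Hfun Ω c ψp ψm μp μm a = y at *
        induction y with
        | bot => exact absurd rfl this
        | coe y => rw [← EReal.coe_mul]; exact EReal.coe_ne_bot _
        | top => rw [EReal.coe_mul_top_of_pos ht0]; exact top_ne_bot
    obtain ⟨u, hu⟩ : ∃ u : ℝ, Hfun Ω c ψp ψm μp μm a = u :=
      ⟨_, (EReal.coe_toReal ha (hbot a)).symm⟩
    obtain ⟨v, hv⟩ : ∃ v : ℝ, Hfun Ω c ψp ψm μp μm b = v :=
      ⟨_, (EReal.coe_toReal hb (hbot b)).symm⟩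
    rw [hu, hv, ← EReal.coe_mul, ← EReal.coe_mul, ← EReal.coe_add]
    apply EReal.le_of_forall_lt_iff_le.1
    intro z hz
    have hz' : t * u + (1 - t) * v < z := by exact_mod_cast hz
    let ε := z - (t * u + (1 - t) * v)
    have hε : 0 < ε := by simp only [ε]; linarith
    obtain ⟨f, g, h1⟩ := A a (u + ε) (by rw [hu]; exact_mod_cast (by linarith))
    obtain ⟨f', g', h2⟩ := A b (v + ε) (by rw [hv]; exact_mod_cast (by linarith))
    have := B _ _ _ _ (rel_convex Ω hΩ c K ψp ψm μp μm a b _ _ t ht0.le ht2.le f g f' g' h1 h2)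
    refine this.trans (le_of_eq ?_)
    congr 1
    simp only [ε]
    ring
  · rw [lowerSemicontinuous_iff_isClosed_preimage]
    intro y
    apply IsSeqClosed.isClosed
    intro u h hu hlim
    apply EReal.le_of_forall_lt_iff_le.1
    intro b hb
    have hex : ∀ n, ∃ p : (Ω →ᵇ ℝ) × (Ω →ᵇ ℝ), RelFeas Ω c K ψp ψm μp μm (u n) b p.1 p.2 := by
      intro n
      obtain ⟨f, g, hR⟩ := A (u n) b (lt_of_le_of_lt (hu n) hb)
      exact ⟨(f, g), hR⟩
    choose p hp using hex
    obtain ⟨R, hR⟩ := (Metric.isBounded_range_of_tendsto u hlim).exists_norm_le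
    obtain ⟨M, hM⟩ := bounds Ω hΩ hfr c K hc ψp ψm μp μm R
    have hcomp := compactness (X := Ω) K M
    obtain ⟨q, -, s, hs, hq⟩ := (hcomp.prod hcomp).tendsto_subseq (x := p) (fun n => by
      obtain ⟨m1, m2⟩ := hM _ _ _ _ (hR _ ⟨n, rfl⟩) (hp n)
      exact ⟨⟨(hp n).1, m1⟩, ⟨(hp n).2.1, m2⟩⟩)
    have := (rel_closed Ω hΩ c K ψp ψm μp μm b).mem_of_tendsto
      ((hlim.comp hs.tendsto_atTop).prodMk_nhds hq) (Eventually.of_forall fun n => hp (s n))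
    exact B _ _ _ _ this
end
end

section
/- Let π be optimal for the tariff transport problem 𝒯₁ and (φ⁺, φ⁻) optimal for the dual 𝒟₁, and write π_x = μ⁺ + ξ⁺, π_y = μ⁻ + ξ⁻ with ξ^± positive measures on ∂Ω. Then φ⁺ = ψ⁺ on the support of ξ⁺ and φ⁻ = ψ⁻ on the support of ξ⁻. -/
open MeasureTheory Set

noncomputable section

variable {d : ℕ}

/-- The support of a positive measure: points all of whose open neighbourhoods have
positive measure. -/
def msupport (ξ : Measure (Euc d)) : Set (Euc d) :=
  {x | ∀ V : Set (Euc d), IsOpen V → x ∈ V → 0 < ξ V}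

open Filter Topology in
lemma bcs_lp {V E : Type*} [AddCommGroup V] [Module ℝ V] [AddCommGroup E] [Module ℝ E]
    [PartialOrder E] [IsOrderedAddMonoid E] [PosSMulMono ℝ E]
    (A : V →ₗ[ℝ] E) (l : V →ₗ[ℝ] ℝ) (b e : E) (he0 : 0 ≤ e)
    (he : ∀ u : E, ∃ s : ℝ, 0 ≤ s ∧ 0 ≤ s • e + u)
    (v0 : V) (h0 : A v0 + e ≤ b) (D : ℝ) (hD : ∀ v, A v ≤ b → l v ≤ D) :
    ∃ L : E →ₗ[ℝ] ℝ, (∀ u, 0 ≤ u → 0 ≤ L u) ∧ (∀ v, L (A v) = l v) ∧ L b ≤ D := by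
  have hv0 : A v0 ≤ b := le_trans (by simpa using he0) h0
  set S : Set ℝ := {r | ∃ v, A v ≤ b ∧ r = l v} with hS
  have hSne : S.Nonempty := ⟨l v0, v0, hv0, rfl⟩
  have hSbdd : BddAbove S := ⟨D, by rintro r ⟨v, hv, rfl⟩; exact hD v hv⟩
  set D0 := sSup S with hD0
  have hD0D : D0 ≤ D := csSup_le hSne (by rintro r ⟨v, hv, rfl⟩; exact hD v hv)
  have hle : ∀ v, A v ≤ b → l v ≤ D0 := fun v hv => le_csSup hSbdd ⟨v, hv, rfl⟩
  -- recession directions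
  have hrec : ∀ v, 0 ≤ A v → 0 ≤ l v := by
    intro v hv
    by_contra hneg
    push Not at hneg
    have key : ∀ s : ℝ, 0 ≤ s → l v0 - s * l v ≤ D0 := by
      intro s hs
      have := hle (v0 - s • v) (by
        rw [map_sub, map_smul]
        exact le_trans (sub_le_self _ (smul_nonneg hs hv)) hv0)
      simpa using this
    have hs := key ((D0 - l v0 + 1) / (- l v)) (div_nonneg (by linarith [hle v0 hv0]) (by linarith))
    have : (D0 - l v0 + 1) / (- l v) * l v = -(D0 - l v0 + 1) := by
      have hne : l v ≠ 0 := hneg.ne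
      field_simp
    linarith
  let F : (V × ℝ × E) →ₗ[ℝ] E :=
    A.comp (LinearMap.fst ℝ V (ℝ × E)) +
      ((LinearMap.toSpanSingleton ℝ E b).comp ((LinearMap.fst ℝ ℝ E).comp (LinearMap.snd ℝ V (ℝ × E)))
       + (LinearMap.snd ℝ ℝ E).comp (LinearMap.snd ℝ V (ℝ × E)))
  have hF : ∀ v t u, F (v, t, u) = A v + (t • b + u) := fun v t u => by simp [F]
  let s : PointedCone ℝ (V × ℝ × E) :=
    { carrier := {p | 0 ≤ F p}
      add_mem' := by
        intro a b ha hb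
        simp only [mem_ofPred_eq, map_add] at *
        exact add_nonneg ha hb
      zero_mem' := by simp
      smul_mem' := by
        intro c x hx
        simp only [mem_ofPred_eq] at *
        have : F (c • x) = (c : ℝ) • F x := by
          rw [← map_smul]; rfl
        rw [this]
        exact smul_nonneg c.2 hx }
  have hs : ∀ v t u, ((v, t, u) ∈ s ↔ 0 ≤ A v + (t • b + u)) := fun v t u => by
    rw [← hF]; rfl
  let G : (V × ℝ × E) →ₗ[ℝ] ℝ :=
    l.comp (LinearMap.fst ℝ V (ℝ × E)) +
      D0 • ((LinearMap.fst ℝ ℝ E).comp (LinearMap.snd ℝ V (ℝ × E)))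
  have hG : ∀ v t u, G (v, t, u) = l v + D0 * t := fun v t u => by simp [G]
  let f : (V × ℝ × E) →ₗ.[ℝ] ℝ :=
    { domain := Submodule.prod ⊤ (Submodule.prod ⊤ ⊥)
      toFun := G.comp (Submodule.subtype _) }
  have hfG : ∀ x : f.domain, f x = G x := fun x => rfl
  obtain ⟨g, hg1, hg2⟩ := riesz_extension s f (by
    rintro ⟨⟨v, t, u⟩, hx⟩ hxs
    have hu : u = 0 := by
      have := hx
      simpa [f, Submodule.mem_prod] using this
    subst hu
    rw [hfG]
    simp only [hG]
    simp only [hs, add_zero] at hxs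
    rcases lt_trichotomy t 0 with ht | ht | ht
    · -- A v ≥ |t| b
      have h1 : ∀ v1, A v1 ≤ b → l v1 ≤ l v / (-t) := by
        intro v1 hv1
        have h2 : 0 ≤ A (v - (-t) • v1) := by
          rw [map_sub, map_smul]
          have h3 : (-t) • A v1 ≤ (-t) • b := smul_le_smul_of_nonneg_left hv1 (by linarith)
          rw [sub_nonneg]
          refine h3.trans ?_
          rw [neg_smul, neg_le_iff_add_nonneg]
          exact hxs
        have := hrec _ h2
        simp only [map_sub, map_smul, smul_eq_mul] at this
        rw [le_div_iff₀ (by linarith)]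
        linarith
      have h2 : D0 ≤ l v / (-t) := csSup_le hSne (by rintro r ⟨v1, hv, rfl⟩; exact h1 v1 hv)
      rw [le_div_iff₀ (by linarith)] at h2
      linarith
    · subst ht
      simp only [zero_smul, add_zero] at hxs
      have := hrec v hxs
      simpa using this
    · have h1 : A (-(t⁻¹) • v) ≤ b := by
        have h2 : 0 ≤ t⁻¹ • (A v + t • b) := smul_nonneg (by positivity) hxs
        rw [smul_add, smul_smul, inv_mul_cancel₀ ht.ne', one_smul] at h2
        rw [map_smul, neg_smul, neg_le_iff_add_nonneg, add_comm]
        exact h2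
      have h3 := hle _ h1
      simp only [map_smul, smul_eq_mul] at h3
      have h4 := mul_le_mul_of_nonneg_left h3 ht.le
      have h5 : t * (-t⁻¹ * l v) = - l v := by field_simp
      linarith) (by
    rintro ⟨v, t, u⟩
    obtain ⟨r, hr, hru⟩ := he u
    refine ⟨⟨(-v + (-r) • v0, -t + r, 0), by simp [f, Submodule.mem_prod]⟩, ?_⟩
    simp only [Prod.mk_add_mk, hs, zero_add]
    refine hru.trans ?_
    have h1 : r • (A v0 + e) ≤ r • b := smul_le_smul_of_nonneg_left h0 hr
    have h2 : A (-v + -r • v0 + v) + ((-t + r + t) • b + u) = (r • b - r • A v0) + u := by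
      have e1 : -v + -r • v0 + v = - (r • v0) := by rw [neg_smul]; abel
      have e2 : -t + r + t = r := by ring
      rw [e1, e2, map_neg, map_smul]; abel
    rw [h2]
    gcongr
    rw [smul_add] at h1
    exact le_sub_iff_add_le'.mpr h1)
  have hgG : ∀ v t, g (v, t, 0) = l v + D0 * t := by
    intro v t
    have := hg1 ⟨(v, t, 0), by simp [f, Submodule.mem_prod]⟩
    rw [this, hfG]
    simp [hG]
  let L : E →ₗ[ℝ] ℝ := g.comp ((LinearMap.inr ℝ V (ℝ × E)).comp (LinearMap.inr ℝ ℝ E))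
  have hL : ∀ u, L u = g (0, 0, u) := fun u => rfl
  have hpos : ∀ v t u, 0 ≤ A v + (t • b + u) → 0 ≤ l v + D0 * t + L u := by
    intro v t u h
    have h1 := hg2 _ ((hs v t u).2 h)
    have h2 : ((v, t, u) : V × ℝ × E) = (v, t, 0) + (0, 0, u) := by simp
    rw [h2, map_add, hgG, ← hL] at h1
    exact h1
  refine ⟨L, ?_, ?_, ?_⟩
  · intro u hu
    simpa using hpos 0 0 u (by simpa using hu)
  · intro v
    have h1 := hpos v 0 (-(A v)) (by simp)
    have h2 := hpos (-v) 0 (A v) (by simp)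
    simp at h1 h2
    linarith
  · have h1 := hpos 0 1 (-b) (by simp)
    simp at h1
    linarith

lemma bcs_rmk {Y : Type*} [TopologicalSpace Y] [T2Space Y] [MeasurableSpace Y] [BorelSpace Y]
    (K : Set Y) (hK : IsCompact K) (L : C(K, ℝ) →ₗ[ℝ] ℝ) (hL : ∀ u, 0 ≤ u → 0 ≤ L u) :
    ∃ m : Measure Y, IsFiniteMeasure m ∧ m Kᶜ = 0 ∧
      ∀ (f : Y → ℝ) (u : C(K, ℝ)), (∀ x : K, u x = f x) → ∫ y, f y ∂m = L u := by
  have : CompactSpace K := isCompact_iff_compactSpace.mp hK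
  have hKm : MeasurableSet K := hK.measurableSet
  let J : CompactlySupportedContinuousMap K ℝ →ₗ[ℝ] C(K, ℝ) :=
    { toFun := fun f => f.toContinuousMap
      map_add' := fun _ _ => rfl
      map_smul' := fun _ _ => rfl }
  let Λ : CompactlySupportedContinuousMap K ℝ →ₚ[ℝ] ℝ :=
    PositiveLinearMap.mk₀ (L.comp J) (fun x hx => hL _ (fun y => hx y))
  refine ⟨(RealRMK.rieszMeasure Λ).map Subtype.val, ?_, ?_, ?_⟩
  · infer_instance
  · rw [Measure.map_apply measurable_subtype_coe hKm.compl]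
    simp
  · intro f u hu
    rw [(MeasurableEmbedding.subtype_coe hKm).integral_map]
    have := RealRMK.integral_rieszMeasure Λ (CompactlySupportedContinuousMap.continuousMapEquiv u)
    have h2 : Λ (CompactlySupportedContinuousMap.continuousMapEquiv u) = L u := rfl
    rw [h2] at this
    rw [← this]
    refine integral_congr_ae (Filter.Eventually.of_forall fun x => ?_)
    exact (hu x).symm

lemma bcs_integrable {Y : Type*} [TopologicalSpace Y] [T2Space Y] [MeasurableSpace Y]
    [BorelSpace Y] [TopologicalSpace.PseudoMetrizableSpace Y]
    {K : Set Y} (hK : IsCompact K) (m : Measure Y) [IsFiniteMeasure m] (hm : m Kᶜ = 0)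
    (f : Y → ℝ) (hf : ContinuousOn f K) : Integrable f m := by
  have h : m.restrict K = m := Measure.restrict_eq_self_of_ae_mem (by
    rw [ae_iff]; exact hm)
  rw [← h]
  exact hf.integrableOn_compact hK

lemma bcs_sup {X : Type*} [TopologicalSpace X] (Ω S : Set X) (hS : IsCompact S)
    (hSne : S.Nonempty) (F : X → X → ℝ)
    (hF : ContinuousOn (fun p : X × X => F p.1 p.2) (Ω ×ˢ S)) :
    ∃ G : X → ℝ, ContinuousOn G Ω ∧ (∀ x ∈ Ω, ∀ y ∈ S, F x y ≤ G x) ∧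
      (∀ x ∈ Ω, ∃ y ∈ S, G x = F x y) := by
  have : CompactSpace S := isCompact_iff_compactSpace.mp hS
  have : Nonempty S := hSne.to_subtype
  let f : Ω → S → ℝ := fun x y => F x y
  have hf : Continuous ↿f := by
    have := hF.comp_continuous (f := fun q : Ω × S => ((q.1 : X), (q.2 : X)))
      (by fun_prop) (fun q => ⟨q.1.2, q.2.2⟩)
    exact this
  have hfx : ∀ x, Continuous (f x) := fun x => hf.comp (by fun_prop : Continuous fun y : S => (x, y))
  have hc := IsCompact.continuous_sSup (isCompact_univ (X := S)) hf
  refine ⟨fun x => sSup (F x '' S), ?_, ?_, ?_⟩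
  · rw [continuousOn_iff_continuous_domRestrict]
    convert hc using 2 with x
    simp only [Set.domRestrict_apply]
    congr 1
    ext r
    simp [f]
  all_goals
    intro x hx
    have hco : IsCompact (F x '' S) := by
      have : F x '' S = f ⟨x, hx⟩ '' univ := by ext r; simp [f]
      rw [this]
      exact isCompact_univ.image (hfx _)
  · intro y hy
    exact le_csSup hco.bddAbove ⟨y, hy, rfl⟩
  · obtain ⟨y, hy, h⟩ := hco.sSup_mem (hSne.image _)
    exact ⟨y, hy, h.symm⟩

lemma bcs_eps {X : Type*} [TopologicalSpace X] (Ω S : Set X) (hΩ : IsCompact Ω) (hS : IsCompact S)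
    (hSΩ : S ⊆ Ω) (hSne : S.Nonempty) (c : X → X → ℝ)
    (hc : ContinuousOn (fun p : X × X => c p.1 p.2) (Ω ×ˢ Ω))
    (ψp ψm : X → ℝ) (hψp : ContinuousOn ψp S)
    (noarb : ∀ x ∈ S, ∀ y ∈ S, ψm y - ψp x ≤ c x y)
    (fp fm : X → ℝ) (hfm : ContinuousOn fm Ω) (ε : ℝ)
    (h1 : ∀ x ∈ Ω, ∀ y ∈ Ω, fm y - fp x ≤ c x y + ε)
    (h2 : ∀ x ∈ S, fp x ≤ ψp x + ε) (h3 : ∀ x ∈ S, ψm x - ε ≤ fm x) (hε : 0 ≤ ε) :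
    ∃ gp gm : X → ℝ, ContinuousOn gp Ω ∧ ContinuousOn gm Ω ∧
      (∀ x ∈ Ω, ∀ y ∈ Ω, gm y - gp x ≤ c x y) ∧ (∀ x ∈ S, gp x ≤ ψp x) ∧
      (∀ x ∈ S, ψm x ≤ gm x) ∧ (∀ x ∈ Ω, gp x ≤ fp x + 2 * ε) ∧
      (∀ x ∈ Ω, fm x - 2 * ε ≤ gm x) := by
  have hΩne : Ω.Nonempty := hSne.mono hSΩ
  have hcs : ContinuousOn (fun p : X × X => c p.2 p.1) (Ω ×ˢ S) := by
    have := hc.comp (f := fun p : X × X => (p.2, p.1)) (s := Ω ×ˢ S) (by fun_prop)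
      (fun p hp => ⟨hSΩ hp.2, hp.1⟩)
    exact this
  have hψ2 : ContinuousOn (fun p : X × X => ψp p.2) (Ω ×ˢ S) :=
    hψp.comp (by fun_prop) (fun p hp => hp.2)
  obtain ⟨G, hGc, hG1, hG2⟩ := bcs_sup Ω S hS hSne (fun y x => -(c x y + ψp x)) (hcs.add hψ2).neg
  set gm : X → ℝ := fun y => min (fm y + ε) (- G y) with hgm
  have hgmc : ContinuousOn gm Ω := (hfm.add continuousOn_const).inf hGc.neg
  have hgm2 : ContinuousOn (fun p : X × X => gm p.2) (Ω ×ˢ Ω) :=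
    hgmc.comp (by fun_prop) (fun p hp => hp.2)
  obtain ⟨gp, hgpc, hgp1, hgp2⟩ := bcs_sup Ω Ω hΩ hΩne (fun x y => gm y - c x y) (hgm2.sub hc)
  refine ⟨gp, gm, hgpc, hgmc, ?_, ?_, ?_, ?_, ?_⟩
  · intro x hx y hy
    have := hgp1 x hx y hy
    linarith
  · intro x hx
    obtain ⟨y, hy, h⟩ := hgp2 x (hSΩ hx)
    have a := hG1 y hy x hx
    have b : gm y ≤ - G y := min_le_right _ _
    linarith
  · intro y hy
    refine le_min (by linarith [h3 y hy]) ?_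
    obtain ⟨x, hx, h⟩ := hG2 y (hSΩ hy)
    linarith [noarb x hx y hy]
  · intro x hx
    obtain ⟨y, hy, h⟩ := hgp2 x hx
    have b : gm y ≤ fm y + ε := min_le_left _ _
    linarith [h1 x hx y hy]
  · intro y hy
    refine le_min (by linarith) ?_
    obtain ⟨x, hx, h⟩ := hG2 y hy
    linarith [h1 x (hSΩ hx) y hy, h2 x hx]

lemma bcs_setint {Y : Type*} [MeasurableSpace Y] (μ ξ : Measure Y) (I F : Set Y)
    (hIF : Disjoint I F) (hμ : μ Iᶜ = 0) (hξ : ξ Fᶜ = 0) :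
    (μ + ξ).restrict I = μ ∧ (μ + ξ).restrict F = ξ := by
  have a1 : μ.restrict I = μ := Measure.restrict_eq_self_of_ae_mem (by rw [ae_iff]; exact hμ)
  have a2 : ξ.restrict F = ξ := Measure.restrict_eq_self_of_ae_mem (by rw [ae_iff]; exact hξ)
  have a3 : ξ.restrict I = 0 := Measure.restrict_eq_zero.2
    (measure_mono_null hIF.subset_compl_right hξ)
  have a4 : μ.restrict F = 0 := Measure.restrict_eq_zero.2
    (measure_mono_null hIF.symm.subset_compl_right hμ)
  simp [Measure.restrict_add, a1, a2, a3, a4]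

lemma bcs_tariff (Ω : Set (Euc d)) (c : Euc d → Euc d → ℝ) (ψp ψm : Euc d → ℝ)
    (μp μm ξp ξm : Measure (Euc d))
    (hμp : μp (interior Ω)ᶜ = 0) (hμm : μm (interior Ω)ᶜ = 0)
    (π : Measure (Euc d × Euc d))
    (hξp : π.map Prod.fst = μp + ξp) (hξm : π.map Prod.snd = μm + ξm)
    (hξps : ξp (frontier Ω)ᶜ = 0) (hξms : ξm (frontier Ω)ᶜ = 0) :
    tariffCost Ω c ψp ψm π = (∫ p, c p.1 p.2 ∂π) + (∫ x, ψp x ∂ξp) - ∫ y, ψm y ∂ξm := by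
  have hd : Disjoint (interior Ω) (frontier Ω) := disjoint_interior_frontier
  rw [tariffCost, hξp, hξm, (bcs_setint μp ξp _ _ hd hμp hξps).2,
    (bcs_setint μm ξm _ _ hd hμm hξms).2]

lemma bcs_plan (Ω : Set (Euc d)) (hΩ : IsCompact Ω)
    (c : Euc d → Euc d → ℝ)
    (hc : ContinuousOn (fun p : Euc d × Euc d => c p.1 p.2) (Ω ×ˢ Ω))
    (ψp ψm : Euc d → ℝ)
    (hψp : ContinuousOn ψp (frontier Ω)) (hψm : ContinuousOn ψm (frontier Ω))
    (μp μm : Measure (Euc d)) [IsFiniteMeasure μp] [IsFiniteMeasure μm]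
    (hμp : μp (interior Ω)ᶜ = 0) (hμm : μm (interior Ω)ᶜ = 0)
    (φp φm : C(Euc d, ℝ))
    (hbp : ∀ x ∈ frontier Ω, φp x ≤ ψp x) (hbm : ∀ x ∈ frontier Ω, ψm x ≤ φm x)
    (hcc : ∀ x ∈ Ω, ∀ y ∈ Ω, φm y - φp x ≤ c x y)
    (ε : ℝ) (hε : 0 < ε) (D : ℝ)
    (hD : ∀ fp fm : C(Euc d, ℝ), (∀ x ∈ Ω, ∀ y ∈ Ω, fm y - fp x ≤ c x y + ε) →
      (∀ x ∈ frontier Ω, fp x ≤ ψp x + ε) → (∀ x ∈ frontier Ω, ψm x - ε ≤ fm x) →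
      (∫ y, fm y ∂μm) - (∫ x, fp x ∂μp) ≤ D) :
    ∃ π ∈ P0 Ω μp μm, tariffCost Ω c ψp ψm π ≤ D := by
  have hfc : IsCompact (frontier Ω) := hΩ.of_isClosed_subset isClosed_frontier
    (hΩ.isClosed.frontier_subset)
  have hPc : IsCompact (Ω ×ˢ Ω) := hΩ.prod hΩ
  have i1 : CompactSpace (Ω ×ˢ Ω : Set (Euc d × Euc d)) := isCompact_iff_compactSpace.mp hPc
  have i2 : CompactSpace (frontier Ω) := isCompact_iff_compactSpace.mp hfc
  have hμp' : μp Ωᶜ = 0 := measure_mono_null (compl_subset_compl.2 interior_subset) hμp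
  have hμm' : μm Ωᶜ = 0 := measure_mono_null (compl_subset_compl.2 interior_subset) hμm
  have intp : ∀ f : C(Euc d, ℝ), Integrable f μp := fun f =>
    bcs_integrable hΩ μp hμp' f f.continuous.continuousOn
  have intm : ∀ f : C(Euc d, ℝ), Integrable f μm := fun f =>
    bcs_integrable hΩ μm hμm' f f.continuous.continuousOn
  let A : (C(Euc d, ℝ) × C(Euc d, ℝ)) →ₗ[ℝ]
      (C((Ω ×ˢ Ω : Set (Euc d × Euc d)), ℝ) × C(frontier Ω, ℝ) × C(frontier Ω, ℝ)) :=
    { toFun := fun v => (⟨fun p => v.2 p.1.2 - v.1 p.1.1, by fun_prop⟩,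
        ⟨fun x => v.1 x, by fun_prop⟩, ⟨fun x => - v.2 x, by fun_prop⟩)
      map_add' := by
        intro v w
        refine Prod.ext ?_ (Prod.ext ?_ ?_) <;> ext x <;> simp <;> ring
      map_smul' := by
        intro r v
        refine Prod.ext ?_ (Prod.ext ?_ ?_) <;> ext x <;> simp <;> ring }
  let l : (C(Euc d, ℝ) × C(Euc d, ℝ)) →ₗ[ℝ] ℝ :=
    { toFun := fun v => (∫ y, v.2 y ∂μm) - ∫ x, v.1 x ∂μp
      map_add' := by
        intro v w
        simp only [Prod.fst_add, Prod.snd_add, ContinuousMap.add_apply]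
        rw [integral_add (intm _) (intm _), integral_add (intp _) (intp _)]
        ring
      map_smul' := by
        intro r v
        simp only [Prod.smul_fst, Prod.smul_snd, ContinuousMap.smul_apply, integral_smul]
        simp
        ring }
  let cc : C((Ω ×ˢ Ω : Set (Euc d × Euc d)), ℝ) :=
    ⟨fun p => c p.1.1 p.1.2, hc.comp_continuous continuous_subtype_val (fun p => p.2)⟩
  let pp : C(frontier Ω, ℝ) := ⟨fun x => ψp x, hψp.comp_continuous continuous_subtype_val (fun p => p.2)⟩
  let pm : C(frontier Ω, ℝ) := ⟨fun x => ψm x, hψm.comp_continuous continuous_subtype_val (fun p => p.2)⟩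
  let e : C((Ω ×ˢ Ω : Set (Euc d × Euc d)), ℝ) × C(frontier Ω, ℝ) × C(frontier Ω, ℝ) :=
    (ContinuousMap.const _ ε, ContinuousMap.const _ ε, ContinuousMap.const _ ε)
  let b0 : C((Ω ×ˢ Ω : Set (Euc d × Euc d)), ℝ) × C(frontier Ω, ℝ) × C(frontier Ω, ℝ) :=
    (cc, pp, -pm)
  have he0 : 0 ≤ e := ⟨fun x => hε.le, fun x => hε.le, fun x => hε.le⟩
  obtain ⟨L, hL0, hLA, hLb⟩ := bcs_lp A l (b0 + e) e he0 (by
      rintro ⟨u1, u2, u3⟩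
      refine ⟨(‖u1‖ + ‖u2‖ + ‖u3‖) / ε, by positivity, ?_, ?_, ?_⟩
      · intro x
        have := (abs_le.1 (u1.norm_coe_le_norm x)).1
        simp [e, hε.ne']
        linarith [norm_nonneg u2, norm_nonneg u3]
      · intro x
        have := (abs_le.1 (u2.norm_coe_le_norm x)).1
        simp [e, hε.ne']
        linarith [norm_nonneg u1, norm_nonneg u3]
      · intro x
        have := (abs_le.1 (u3.norm_coe_le_norm x)).1
        simp [e, hε.ne']
        linarith [norm_nonneg u1, norm_nonneg u2]) (φp, φm) (by
      gcongr
      refine ⟨?_, ?_, ?_⟩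
      · intro p
        exact hcc _ p.2.1 _ p.2.2
      · intro x
        exact hbp _ x.2
      · intro x
        exact neg_le_neg (hbm _ x.2)) D (by
      rintro ⟨fp, fm⟩ ⟨h1, h2, h3⟩
      refine hD fp fm ?_ ?_ ?_
      · intro x hx y hy
        exact h1 ⟨(x, y), hx, hy⟩
      · intro x hx
        exact h2 ⟨x, hx⟩
      · intro x hx
        have : - fm x ≤ - ψm x + ε := h3 ⟨x, hx⟩
        linarith)
  let L1 := L.comp (LinearMap.inl ℝ (C((Ω ×ˢ Ω : Set (Euc d × Euc d)), ℝ)) (C(frontier Ω, ℝ) × C(frontier Ω, ℝ)))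
  let L2 := L.comp ((LinearMap.inr ℝ (C((Ω ×ˢ Ω : Set (Euc d × Euc d)), ℝ)) (C(frontier Ω, ℝ) × C(frontier Ω, ℝ))).comp (LinearMap.inl ℝ _ _))
  let L3 := L.comp ((LinearMap.inr ℝ (C((Ω ×ˢ Ω : Set (Euc d × Euc d)), ℝ)) (C(frontier Ω, ℝ) × C(frontier Ω, ℝ))).comp (LinearMap.inr ℝ _ _))
  have hsplit : ∀ u1 u2 u3, L (u1, u2, u3) = L1 u1 + L2 u2 + L3 u3 := by
    intro u1 u2 u3
    simp only [L1, L2, L3, LinearMap.comp_apply, ← map_add]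
    simp
  obtain ⟨m1, fin1, hm1, hi1⟩ := bcs_rmk _ hPc L1 (fun u hu => hL0 _ ⟨hu, le_rfl, le_rfl⟩)
  obtain ⟨m2, fin2, hm2, hi2⟩ := bcs_rmk _ hfc L2 (fun u hu => hL0 _ ⟨le_rfl, hu, le_rfl⟩)
  obtain ⟨m3, fin3, hm3, hi3⟩ := bcs_rmk _ hfc L3 (fun u hu => hL0 _ ⟨le_rfl, le_rfl, hu⟩)
  have int2 : ∀ f : C(Euc d, ℝ), Integrable f m2 := fun f =>
    bcs_integrable hfc m2 hm2 f f.continuous.continuousOn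
  have int3 : ∀ f : C(Euc d, ℝ), Integrable f m3 := fun f =>
    bcs_integrable hfc m3 hm3 f f.continuous.continuousOn
  have hx : m1.map Prod.fst = μp + m2 := by
    apply ext_of_forall_integral_eq_of_IsFiniteMeasure
    intro f
    have h := hLA (f.toContinuousMap, 0)
    rw [integral_map measurable_fst.aemeasurable f.continuous.aestronglyMeasurable,
      integral_add_measure (f := f) (intp f.toContinuousMap) (int2 f.toContinuousMap)]
    have e1 := hi1 (fun p => - f p.1) (A (f.toContinuousMap, 0)).1 (fun p => by simp [A])
    have e2 := hi2 f (A (f.toContinuousMap, 0)).2.1 (fun p => by simp [A])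
    have e3 := hi3 (fun _ => 0) (A (f.toContinuousMap, 0)).2.2 (fun p => by simp [A])
    have e4 := hsplit (A (f.toContinuousMap, 0)).1 (A (f.toContinuousMap, 0)).2.1 (A (f.toContinuousMap, 0)).2.2
    have e5 : l (f.toContinuousMap, 0) = - ∫ x, f x ∂μp := by simp [l]
    rw [integral_neg] at e1
    rw [integral_zero] at e3
    rw [e5] at h
    rw [← e1, ← e2, ← e3] at e4
    change L (A (f.toContinuousMap, 0)) = _ at e4
    linarith
  have hy : m1.map Prod.snd = μm + m3 := by
    apply ext_of_forall_integral_eq_of_IsFiniteMeasure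
    intro f
    have h := hLA (0, f.toContinuousMap)
    rw [integral_map measurable_snd.aemeasurable f.continuous.aestronglyMeasurable,
      integral_add_measure (f := f) (intm f.toContinuousMap) (int3 f.toContinuousMap)]
    have e1 := hi1 (fun p => f p.2) (A (0, f.toContinuousMap)).1 (fun p => by simp [A])
    have e2 := hi2 (fun _ => 0) (A (0, f.toContinuousMap)).2.1 (fun p => by simp [A])
    have e3 := hi3 (fun x => - f x) (A (0, f.toContinuousMap)).2.2 (fun p => by simp [A])
    have e4 := hsplit (A (0, f.toContinuousMap)).1 (A (0, f.toContinuousMap)).2.1 (A (0, f.toContinuousMap)).2.2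
    have e5 : l (0, f.toContinuousMap) = ∫ x, f x ∂μm := by simp [l]
    rw [integral_neg] at e3
    rw [integral_zero] at e2
    rw [e5] at h
    rw [← e1, ← e2, ← e3] at e4
    change L (A (0, f.toContinuousMap)) = _ at e4
    linarith
  have hd : Disjoint (interior Ω) (frontier Ω) := disjoint_interior_frontier
  refine ⟨m1, ⟨fin1, hm1, ?_, ?_⟩, ?_⟩
  · rw [hx]; exact (bcs_setint μp m2 _ _ hd hμp hm2).1
  · rw [hy]; exact (bcs_setint μm m3 _ _ hd hμm hm3).1
  · rw [bcs_tariff Ω c ψp ψm μp μm m2 m3 hμp hμm m1 hx hy hm2 hm3]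
    have e1 := hi1 (fun p => c p.1 p.2) cc (fun p => rfl)
    have e2 := hi2 ψp pp (fun p => rfl)
    have e3 := hi3 ψm pm (fun p => rfl)
    have e4 := hsplit cc pp (-pm)
    rw [map_neg] at e4
    have e5 := hL0 e he0
    rw [map_add] at hLb
    change L b0 = _ at e4
    rw [e1, e2, e3]
    linarith

open Filter Topology in
lemma bcs_relax (Ω : Set (Euc d)) (hΩ : IsCompact Ω) (hfr : (frontier Ω).Nonempty)
    (c : Euc d → Euc d → ℝ) (ψp ψm : Euc d → ℝ)
    (μp μm : Measure (Euc d)) [IsFiniteMeasure μp] [IsFiniteMeasure μm]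
    (hμp : μp (interior Ω)ᶜ = 0) (hμm : μm (interior Ω)ᶜ = 0)
    (φp φm : Euc d → ℝ) (hφpc : ContinuousOn φp Ω) (hφmc : ContinuousOn φm Ω)
    (hbc : ∀ x ∈ frontier Ω, ψm x ≤ φm x ∧ φm x ≤ φp x ∧ φp x ≤ ψp x)
    (M : ℝ)
    (hφopt : ∀ φp' φm' : Euc d → ℝ, ContinuousOn φp' Ω → ContinuousOn φm' Ω →
      (∀ x ∈ frontier Ω, ψm x ≤ φm' x ∧ φm' x ≤ φp' x ∧ φp' x ≤ ψp x) →
      (∀ x ∈ Ω, ∀ y ∈ Ω, φm' y - φp' x ≤ c x y) →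
      (∫ y, φm' y ∂μm) - (∫ x, φp' x ∂μp) ≤ M)
    (gp gm : Euc d → ℝ) (hgp : ContinuousOn gp Ω) (hgm : ContinuousOn gm Ω)
    (h1 : ∀ x ∈ Ω, ∀ y ∈ Ω, gm y - gp x ≤ c x y) (h2 : ∀ x ∈ frontier Ω, gp x ≤ ψp x)
    (h3 : ∀ x ∈ frontier Ω, ψm x ≤ gm x) :
    (∫ y, gm y ∂μm) - (∫ x, gp x ∂μp) ≤ M := by
  have hμp' : μp Ωᶜ = 0 := measure_mono_null (compl_subset_compl.2 interior_subset) hμp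
  have hμm' : μm Ωᶜ = 0 := measure_mono_null (compl_subset_compl.2 interior_subset) hμm
  have hfΩ : frontier Ω ⊆ Ω := hΩ.isClosed.frontier_subset
  let ρ : ℕ → Euc d → ℝ := fun n x => max 0 (1 - n * Metric.infDist x (frontier Ω))
  have hρc : ∀ n, Continuous (ρ n) := fun n => by
    have := Metric.continuous_infDist_pt (frontier Ω)
    fun_prop
  have hρ0 : ∀ n x, 0 ≤ ρ n x := fun n x => le_max_left _ _
  have hρ1 : ∀ n x, ρ n x ≤ 1 := fun n x => max_le (by norm_num) (by
    have : 0 ≤ (n : ℝ) * Metric.infDist x (frontier Ω) := mul_nonneg (by positivity) Metric.infDist_nonneg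
    linarith)
  have hρf : ∀ n, ∀ x ∈ frontier Ω, ρ n x = 1 := fun n x hx => by
    simp [ρ, Metric.infDist_zero_of_mem hx]
  have hρlim : ∀ x, x ∈ interior Ω → Tendsto (fun n => ρ n x) atTop (𝓝 0) := by
    intro x hx
    have hpos : 0 < Metric.infDist x (frontier Ω) := by
      rw [← isClosed_frontier.notMem_iff_infDist_pos hfr]
      exact fun h => (disjoint_interior_frontier (s := Ω)).le_bot ⟨hx, h⟩
    obtain ⟨N, hN⟩ := exists_nat_gt (1 / Metric.infDist x (frontier Ω))
    refine tendsto_const_nhds.congr' ?_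
    filter_upwards [eventually_ge_atTop N] with n hn
    rw [div_lt_iff₀ hpos] at hN
    have : (N : ℝ) * Metric.infDist x (frontier Ω) ≤ n * Metric.infDist x (frontier Ω) := by
      gcongr
    simp only [ρ]
    rw [max_eq_left]
    linarith
  -- generic limit
  have lim : ∀ (μ : Measure (Euc d)) [IsFiniteMeasure μ], μ (interior Ω)ᶜ = 0 → μ Ωᶜ = 0 →
      ∀ f h : Euc d → ℝ, ContinuousOn f Ω → ContinuousOn h Ω →
      Tendsto (fun n => ∫ x, f x + ρ n x * h x ∂μ) atTop (𝓝 (∫ x, f x ∂μ)) := by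
    intro μ _ hμ hμ' f h hf hh
    have If := bcs_integrable hΩ μ hμ' f hf
    have Ih := bcs_integrable hΩ μ hμ' h hh
    refine tendsto_integral_of_dominated_convergence (fun x => |f x| + |h x|) ?_
      (If.abs.add Ih.abs) ?_ ?_
    · intro n
      exact (bcs_integrable hΩ μ hμ' _
        (hf.add ((hρc n).continuousOn.mul hh))).aestronglyMeasurable
    · intro n
      refine Eventually.of_forall fun x => ?_
      rw [Real.norm_eq_abs]
      refine (abs_add_le _ _).trans ?_
      rw [abs_mul, abs_of_nonneg (hρ0 n x)]
      gcongr
      exact mul_le_of_le_one_left (abs_nonneg _) (hρ1 n x)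
    · have : ∀ᵐ x ∂μ, x ∈ interior Ω := by rw [ae_iff]; exact hμ
      filter_upwards [this] with x hx
      simpa using ((hρlim x hx).mul_const (h x)).const_add (f x)
  have lm := lim μm hμm hμm' gm (fun x => min (gm x) (φm x) - gm x) hgm ((hgm.inf hφmc).sub hgm)
  have lp := lim μp hμp hμp' gp (fun x => max (gp x) (φp x) - gp x) hgp ((hgp.sup hφpc).sub hgp)
  refine le_of_tendsto' (lm.sub lp) fun n => ?_
  refine hφopt _ _ (hgp.add ((hρc n).continuousOn.mul ((hgp.sup hφpc).sub hgp)))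
    (hgm.add ((hρc n).continuousOn.mul ((hgm.inf hφmc).sub hgm))) ?_ ?_
  · intro x hx
    obtain ⟨a, b, c'⟩ := hbc x hx
    simp only [hρf n x hx, one_mul, add_sub_cancel]
    exact ⟨le_min (h3 x hx) a, (min_le_right _ _).trans (b.trans (le_max_right _ _)),
      max_le (h2 x hx) c'⟩
  · intro x hx y hy
    have a1 : ρ n y * (min (gm y) (φm y) - gm y) ≤ 0 :=
      mul_nonpos_of_nonneg_of_nonpos (hρ0 n y) (by linarith [min_le_left (gm y) (φm y)])
    have a2 : 0 ≤ ρ n x * (max (gp x) (φp x) - gp x) :=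
      mul_nonneg (hρ0 n x) (by linarith [le_max_left (gp x) (φp x)])
    linarith [h1 x hx y hy]

lemma bcs_supp (F : Set (Euc d)) (hF : IsCompact F) (ξ : Measure (Euc d)) [IsFiniteMeasure ξ]
    (hξ : ξ Fᶜ = 0) (h : Euc d → ℝ) (hc : ContinuousOn h F) (h0 : ∀ x ∈ F, 0 ≤ h x)
    (hint : ∫ x, h x ∂ξ ≤ 0) : ∀ x ∈ msupport ξ, h x = 0 := by
  intro x hx
  have haeF : ∀ᵐ x ∂ξ, x ∈ F := by rw [ae_iff]; exact hξ
  have hnn : 0 ≤ᵐ[ξ] h := by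
    filter_upwards [haeF] with y hy using h0 y hy
  have hz : ∫ x, h x ∂ξ = 0 := le_antisymm hint (integral_nonneg_of_ae hnn)
  rw [integral_eq_zero_iff_of_nonneg_ae hnn (bcs_integrable hF ξ hξ h hc)] at hz
  have hxF : x ∈ F := by
    by_contra hn
    exact (hx Fᶜ hF.isClosed.isOpen_compl hn).ne' hξ
  by_contra hne
  have hpos : 0 < h x := lt_of_le_of_ne (h0 x hxF) (Ne.symm hne)
  obtain ⟨V, hVo, hxV, hV⟩ := mem_nhdsWithin.1 ((hc x hxF).eventually (lt_mem_nhds hpos))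
  have := hx V hVo hxV
  refine this.ne' ?_
  have : ∀ᵐ y ∂ξ, y ∉ V := by
    filter_upwards [haeF, hz] with y hy hy0 hyV
    have : 0 < h y := hV ⟨hyV, hy⟩
    rw [hy0] at this
    exact lt_irrefl _ this
  rw [ae_iff] at this
  simpa using this

/-- Proposition 3.3: complementary slackness on the boundary.  If `π`
is optimal for `𝒯₁` and `(φ⁺,φ⁻)` is optimal for `𝒟₁`, and `π_x = μ⁺ + ξ⁺`,
`π_y = μ⁻ + ξ⁻` with `ξ^±` supported on `∂Ω`, then `φ⁺ = ψ⁺` on `spt ξ⁺` and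
`φ⁻ = ψ⁻` on `spt ξ⁻`. -/
theorem boundary_complementary_slackness (Ω : Set (Euc d)) (hΩ : IsCompact Ω)
    (hΩne : Ω.Nonempty) (hfr : (frontier Ω).Nonempty)
    (c : Euc d → Euc d → ℝ) (K : NNReal)
    (hc : LipschitzOnWith K (fun p : Euc d × Euc d => c p.1 p.2) (Ω ×ˢ Ω))
    (ψp ψm : Euc d → ℝ)
    (hψp : ContinuousOn ψp (frontier Ω)) (hψm : ContinuousOn ψm (frontier Ω))
    (noarb : ∀ x ∈ frontier Ω, ∀ y ∈ frontier Ω, ψm y - ψp x ≤ c x y)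
    (μp μm : Measure (Euc d)) [IsFiniteMeasure μp] [IsFiniteMeasure μm]
    (hμp : μp (interior Ω)ᶜ = 0) (hμm : μm (interior Ω)ᶜ = 0)
    -- π is an optimal plan for 𝒯₁
    (π : Measure (Euc d × Euc d)) (hπ : π ∈ P0 Ω μp μm)
    (hπopt : ∀ π' ∈ P0 Ω μp μm, tariffCost Ω c ψp ψm π ≤ tariffCost Ω c ψp ψm π')
    -- (φ⁺, φ⁻) is an optimal pair for 𝒟₁
    (φp φm : Euc d → ℝ) (hφpc : ContinuousOn φp Ω) (hφmc : ContinuousOn φm Ω)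
    (hbc : ∀ x ∈ frontier Ω, ψm x ≤ φm x ∧ φm x ≤ φp x ∧ φp x ≤ ψp x)
    (hcc : ∀ x ∈ Ω, ∀ y ∈ Ω, φm y - φp x ≤ c x y)
    (hφopt : ∀ φp' φm' : Euc d → ℝ, ContinuousOn φp' Ω → ContinuousOn φm' Ω →
      (∀ x ∈ frontier Ω, ψm x ≤ φm' x ∧ φm' x ≤ φp' x ∧ φp' x ≤ ψp x) →
      (∀ x ∈ Ω, ∀ y ∈ Ω, φm' y - φp' x ≤ c x y) →
      (∫ y, φm' y ∂μm) - (∫ x, φp' x ∂μp) ≤ (∫ y, φm y ∂μm) - ∫ x, φp x ∂μp)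
    -- the boundary import/export parts of the marginals of π
    (ξp ξm : Measure (Euc d))
    (hξp : π.map Prod.fst = μp + ξp) (hξm : π.map Prod.snd = μm + ξm)
    (hξps : ξp (frontier Ω)ᶜ = 0) (hξms : ξm (frontier Ω)ᶜ = 0) :
    (∀ x ∈ msupport ξp, φp x = ψp x) ∧ (∀ y ∈ msupport ξm, φm y = ψm y) := by
  have hcc' := hc.continuousOn
  have hfΩ : frontier Ω ⊆ Ω := hΩ.isClosed.frontier_subset
  have hfc : IsCompact (frontier Ω) := hΩ.of_isClosed_subset isClosed_frontier hfΩ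
  have hPc : IsCompact (Ω ×ˢ Ω) := hΩ.prod hΩ
  have hμp' : μp Ωᶜ = 0 := measure_mono_null (compl_subset_compl.2 interior_subset) hμp
  have hμm' : μm Ωᶜ = 0 := measure_mono_null (compl_subset_compl.2 interior_subset) hμm
  have hξp' : ξp Ωᶜ = 0 := measure_mono_null (compl_subset_compl.2 hfΩ) hξps
  have hξm' : ξm Ωᶜ = 0 := measure_mono_null (compl_subset_compl.2 hfΩ) hξms
  have finπ : IsFiniteMeasure π := hπ.1
  have finp : IsFiniteMeasure ξp := isFiniteMeasure_of_le (π.map Prod.fst) (by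
    rw [hξp]; exact Measure.le_add_left le_rfl)
  have finm : IsFiniteMeasure ξm := isFiniteMeasure_of_le (π.map Prod.snd) (by
    rw [hξm]; exact Measure.le_add_left le_rfl)
  set M := (∫ y, φm y ∂μm) - ∫ x, φp x ∂μp with hM
  -- continuous extensions of the optimal potentials
  obtain ⟨Fp, hFp⟩ := ContinuousMap.exists_restrict_eq hΩ.isClosed
    ⟨fun x : Ω => φp x, hφpc.comp_continuous continuous_subtype_val (fun p => p.2)⟩
  obtain ⟨Fm, hFm⟩ := ContinuousMap.exists_restrict_eq hΩ.isClosed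
    ⟨fun x : Ω => φm x, hφmc.comp_continuous continuous_subtype_val (fun p => p.2)⟩
  have eFp : ∀ x ∈ Ω, Fp x = φp x := fun x hx => DFunLike.congr_fun hFp ⟨x, hx⟩
  have eFm : ∀ x ∈ Ω, Fm x = φm x := fun x hx => DFunLike.congr_fun hFm ⟨x, hx⟩
  -- strong duality
  have hdual : tariffCost Ω c ψp ψm π ≤ M := by
    set C := 2 * (μm.real univ + μp.real univ) with hC
    have hC0 : 0 ≤ C := by positivity
    have key : ∀ ε : ℝ, 0 < ε → tariffCost Ω c ψp ψm π ≤ M + C * ε := by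
      intro ε hε
      obtain ⟨π', hπ', hle⟩ := bcs_plan Ω hΩ c hcc' ψp ψm hψp hψm μp μm hμp hμm Fp Fm
        (fun x hx => by rw [eFp x (hfΩ hx)]; exact (hbc x hx).2.2)
        (fun x hx => by rw [eFm x (hfΩ hx)]; exact (hbc x hx).1)
        (fun x hx y hy => by rw [eFp x hx, eFm y hy]; exact hcc x hx y hy)
        ε hε (M + C * ε) (by
          intro fp fm h1 h2 h3
          obtain ⟨gp, gm, hgpc, hgmc, k1, k2, k3, k4, k5⟩ := bcs_eps Ω (frontier Ω) hΩ hfc hfΩ hfr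
            c hcc' ψp ψm hψp noarb fp fm fm.continuous.continuousOn ε h1 h2 h3 hε.le
          have hr := bcs_relax Ω hΩ hfr c ψp ψm μp μm hμp hμm φp φm hφpc hφmc hbc M hφopt
            gp gm hgpc hgmc k1 k2 k3
          have haem : ∀ᵐ x ∂μm, x ∈ Ω := by rw [ae_iff]; exact hμm'
          have haep : ∀ᵐ x ∂μp, x ∈ Ω := by rw [ae_iff]; exact hμp'
          have Ifm := bcs_integrable hΩ μm hμm' fm fm.continuous.continuousOn
          have Ifp := bcs_integrable hΩ μp hμp' fp fp.continuous.continuousOn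
          have a1 : ∫ y, (fm y - 2 * ε) ∂μm ≤ ∫ y, gm y ∂μm :=
            integral_mono_ae (Ifm.sub (integrable_const _)) (bcs_integrable hΩ μm hμm' gm hgmc)
              (by filter_upwards [haem] with y hy using k5 y hy)
          have a2 : ∫ y, gp y ∂μp ≤ ∫ y, (fp y + 2 * ε) ∂μp :=
            integral_mono_ae (bcs_integrable hΩ μp hμp' gp hgpc) (Ifp.add (integrable_const _))
              (by filter_upwards [haep] with y hy using k4 y hy)
          rw [integral_sub Ifm (integrable_const _), integral_const, smul_eq_mul] at a1
          rw [integral_add Ifp (integrable_const _), integral_const, smul_eq_mul] at a2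
          have : C * ε = μm.real univ * (2 * ε) + μp.real univ * (2 * ε) := by rw [hC]; ring
          linarith)
      exact (hπopt π' hπ').trans hle
    refine le_of_forall_pos_le_add fun δ hδ => ?_
    have := key (δ / (C + 1)) (by positivity)
    have h2 : C * (δ / (C + 1)) ≤ δ := by
      rw [mul_div_assoc', div_le_iff₀ (by positivity)]
      nlinarith
    linarith
  rw [bcs_tariff Ω c ψp ψm μp μm ξp ξm hμp hμm π hξp hξm hξps hξms] at hdual
  -- marginals
  have haeπ : ∀ᵐ p ∂π, p ∈ Ω ×ˢ Ω := by rw [ae_iff]; exact hπ.2.1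
  have IFm : Integrable (fun p : Euc d × Euc d => Fm p.2) π :=
    bcs_integrable hPc π hπ.2.1 _ (by fun_prop)
  have IFp : Integrable (fun p : Euc d × Euc d => Fp p.1) π :=
    bcs_integrable hPc π hπ.2.1 _ (by fun_prop)
  have b1 : ∫ p, (Fm p.2 - Fp p.1) ∂π ≤ ∫ p, c p.1 p.2 ∂π :=
    integral_mono_ae (IFm.sub IFp) (bcs_integrable hPc π hπ.2.1 _ hcc') (by
      filter_upwards [haeπ] with p hp
      rw [eFp _ hp.1, eFm _ hp.2]
      exact hcc _ hp.1 _ hp.2)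
  rw [integral_sub IFm IFp] at b1
  have ext_int : ∀ (μ : Measure (Euc d)), μ Ωᶜ = 0 → ∀ f g : Euc d → ℝ, (∀ x ∈ Ω, f x = g x) →
      ∫ x, f x ∂μ = ∫ x, g x ∂μ := by
    intro μ hμ f g hfg
    have : ∀ᵐ x ∂μ, x ∈ Ω := by rw [ae_iff]; exact hμ
    exact integral_congr_ae (by filter_upwards [this] with x hx using hfg x hx)
  have b2 : ∫ p, Fm p.2 ∂π = (∫ y, φm y ∂μm) + ∫ y, φm y ∂ξm := by
    rw [← integral_map (f := fun y => Fm y) measurable_snd.aemeasurable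
      Fm.continuous.aestronglyMeasurable, hξm,
      integral_add_measure (bcs_integrable hΩ μm hμm' _ Fm.continuous.continuousOn)
        (bcs_integrable hΩ ξm hξm' _ Fm.continuous.continuousOn),
      ext_int μm hμm' _ _ eFm, ext_int ξm hξm' _ _ eFm]
  have b3 : ∫ p, Fp p.1 ∂π = (∫ y, φp y ∂μp) + ∫ y, φp y ∂ξp := by
    rw [← integral_map (f := fun y => Fp y) measurable_fst.aemeasurable
      Fp.continuous.aestronglyMeasurable, hξp,
      integral_add_measure (bcs_integrable hΩ μp hμp' _ Fp.continuous.continuousOn)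
        (bcs_integrable hΩ ξp hξp' _ Fp.continuous.continuousOn),
      ext_int μp hμp' _ _ eFp, ext_int ξp hξp' _ _ eFp]
  have c1 : ContinuousOn (fun x => ψp x - φp x) (frontier Ω) := hψp.sub (hφpc.mono hfΩ)
  have c2 : ContinuousOn (fun x => φm x - ψm x) (frontier Ω) := (hφmc.mono hfΩ).sub hψm
  have n1 : ∀ x ∈ frontier Ω, 0 ≤ ψp x - φp x := fun x hx => by linarith [(hbc x hx).2.2]
  have n2 : ∀ x ∈ frontier Ω, 0 ≤ φm x - ψm x := fun x hx => by linarith [(hbc x hx).1]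
  have e1 : ∫ x, (ψp x - φp x) ∂ξp = (∫ x, ψp x ∂ξp) - ∫ x, φp x ∂ξp :=
    integral_sub (bcs_integrable hfc ξp hξps _ hψp) (bcs_integrable hΩ ξp hξp' _ hφpc)
  have e2 : ∫ x, (φm x - ψm x) ∂ξm = (∫ x, φm x ∂ξm) - ∫ x, ψm x ∂ξm :=
    integral_sub (bcs_integrable hΩ ξm hξm' _ hφmc) (bcs_integrable hfc ξm hξms _ hψm)
  have p1 : 0 ≤ ∫ x, (ψp x - φp x) ∂ξp := integral_nonneg_of_ae (by
    have : ∀ᵐ x ∂ξp, x ∈ frontier Ω := by rw [ae_iff]; exact hξps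
    filter_upwards [this] with x hx using n1 x hx)
  have p2 : 0 ≤ ∫ x, (φm x - ψm x) ∂ξm := integral_nonneg_of_ae (by
    have : ∀ᵐ x ∂ξm, x ∈ frontier Ω := by rw [ae_iff]; exact hξms
    filter_upwards [this] with x hx using n2 x hx)
  constructor
  · intro x hx
    have := bcs_supp (frontier Ω) hfc ξp hξps _ c1 n1 (by linarith) x hx
    linarith
  · intro x hx
    have := bcs_supp (frontier Ω) hfc ξm hξms _ c2 n2 (by linarith) x hx
    linarith
end
end
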